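/- arXiv:math/0010071 — 2 statements merged into one kernel-verified Lean document; each statement's English description precedes it below -/
import Mathlib

section
/- There exists a constant C > 0 such that for every smooth function h : ℝ² → ℝ with compact support and every closed disk D = closedBall(z,r) of radius r > 0 in ℝ², the mean oscillation of ∂₁∂₂h over D satisfies (1/(π r²)) ∫_D |∂₁∂₂h(x) − Avg_D(∂₁∂₂h)| dx ≤ C · sup_{x ∈ ℝ²} |Δh(x)|. -/
open MeasureTheory Metric Real

/-- The partial derivative of `h : ℝ² → ℝ` in the `i`-th coordinate direction. -/
noncomputable def pd (i : Fin 2) (h : EuclideanSpace ℝ (Fin 2) → ℝ)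
    (x : EuclideanSpace ℝ (Fin 2)) : ℝ :=
  fderiv ℝ h x (EuclideanSpace.single i 1)

abbrev E2 := EuclideanSpace ℝ (Fin 2)

def SC (F : E2 → ℝ) : Prop := ContDiff ℝ ((⊤ : ℕ∞) : WithTop ℕ∞) F ∧ HasCompactSupport F

noncomputable def lap (F : E2 → ℝ) (x : E2) : ℝ := pd 0 (pd 0 F) x + pd 1 (pd 1 F) x

noncomputable def TT (k : E2 → ℝ) (s : ℝ) (F : E2 → ℝ) (x : E2) : ℝ := ∫ y, F (x - s • y) * k y

lemma cd_pd {F : E2 → ℝ} (h : ContDiff ℝ ((⊤ : ℕ∞) : WithTop ℕ∞) F) (i : Fin 2) :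
    ContDiff ℝ ((⊤ : ℕ∞) : WithTop ℕ∞) (pd i F) := by
  have : ContDiff ℝ ((⊤ : ℕ∞) : WithTop ℕ∞) (fderiv ℝ F) := h.fderiv_right (by simp)
  exact this.clm_apply contDiff_const

lemma SC.pd {F : E2 → ℝ} (h : SC F) (i : Fin 2) : SC (pd i F) :=
  ⟨cd_pd h.1 i, h.2.fderiv_apply ℝ _⟩

lemma cdiff {F : E2 → ℝ} (h : ContDiff ℝ ((⊤ : ℕ∞) : WithTop ℕ∞) F) : Differentiable ℝ F :=
  h.differentiable (by simp)

lemma SC.diff {F : E2 → ℝ} (h : SC F) : Differentiable ℝ F := cdiff h.1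

lemma SC.int {F : E2 → ℝ} (h : SC F) : Integrable F :=
  h.1.continuous.integrable_of_hasCompactSupport h.2

lemma pd_aff {F : E2 → ℝ} (h : Differentiable ℝ F) (i : Fin 2) (a : E2) (c : ℝ) (y : E2) :
    _root_.pd i (fun y => F (a + c • y)) y = c * _root_.pd i F (a + c • y) := by
  unfold _root_.pd
  have h1 : HasFDerivAt (fun y : E2 => a + c • y) (c • ContinuousLinearMap.id ℝ E2) y :=
    ((hasFDerivAt_id y).const_smul c).const_add a
  have := ((h (a + c • y)).hasFDerivAt.comp y h1).fderiv
  change (fderiv ℝ (F ∘ fun y => a + c • y) y) _ = _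
  rw [this]
  simp

lemma pd_comm {F : E2 → ℝ} (h : ContDiff ℝ ((⊤ : ℕ∞) : WithTop ℕ∞) F) (i j : Fin 2) :
    _root_.pd i (_root_.pd j F) = _root_.pd j (_root_.pd i F) := by
  have h1 : ContDiff ℝ ((⊤ : ℕ∞) : WithTop ℕ∞) (fderiv ℝ F) := h.fderiv_right (by simp)
  have key : ∀ i j : Fin 2, ∀ x, _root_.pd i (_root_.pd j F) x =
      fderiv ℝ (fderiv ℝ F) x (EuclideanSpace.single i 1) (EuclideanSpace.single j 1) := by
    intro i j x
    have hd : HasFDerivAt (fderiv ℝ F) (fderiv ℝ (fderiv ℝ F) x) x :=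
      (h1.differentiable (by simp) x).hasFDerivAt
    have := (hd.clm_apply (hasFDerivAt_const (EuclideanSpace.single j (1:ℝ) : E2) x)).fderiv
    unfold _root_.pd
    rw [this]; simp
  funext x
  rw [key, key]
  have := (h.contDiffAt (x := x)).isSymmSndFDerivAt (by
    simp only [minSmoothness_of_isRCLikeNormedField]
    exact WithTop.coe_le_coe.2 (le_top : (2:ℕ∞) ≤ ⊤))
  exact this _ _

lemma pd_add {F G : E2 → ℝ} (hF : Differentiable ℝ F) (hG : Differentiable ℝ G) (i : Fin 2) (x) :
    _root_.pd i (fun x => F x + G x) x = _root_.pd i F x + _root_.pd i G x := by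
  unfold _root_.pd
  rw [fderiv_fun_add (hF x) (hG x)]; rfl

lemma pd_sub {F G : E2 → ℝ} (hF : Differentiable ℝ F) (hG : Differentiable ℝ G) (i : Fin 2) (x) :
    _root_.pd i (fun x => F x - G x) x = _root_.pd i F x - _root_.pd i G x := by
  unfold _root_.pd
  rw [fderiv_fun_sub (hF x) (hG x)]; rfl

lemma pd_mul {F G : E2 → ℝ} (hF : Differentiable ℝ F) (hG : Differentiable ℝ G) (i : Fin 2) (x) :
    _root_.pd i (fun x => F x * G x) x = F x * _root_.pd i G x + G x * _root_.pd i F x := by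
  unfold _root_.pd
  rw [fderiv_fun_mul (hF x) (hG x)]; rfl

lemma SC.lap {F : E2 → ℝ} (h : SC F) : SC (lap F) :=
  ⟨((h.pd 0).pd 0).1.add ((h.pd 1).pd 1).1, ((h.pd 0).pd 0).2.add ((h.pd 1).pd 1).2⟩

lemma lap_pd {F : E2 → ℝ} (h : SC F) (j : Fin 2) :
    _root_.lap (_root_.pd j F) = _root_.pd j (_root_.lap F) := by
  funext x
  have := pd_add ((h.pd 0).pd 0).diff ((h.pd 1).pd 1).diff j x
  unfold _root_.lap
  rw [this, pd_comm h.1 0 j, pd_comm h.1 1 j, pd_comm (h.pd 0).1 0 j, pd_comm (h.pd 1).1 1 j]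

lemma ibp {F K : E2 → ℝ} (hF : ContDiff ℝ ((⊤ : ℕ∞) : WithTop ℕ∞) F) (hK : SC K) (i : Fin 2) :
    ∫ y, _root_.pd i F y * K y = - ∫ y, F y * _root_.pd i K y := by
  have h1 : Integrable (fun y => F y * K y) :=
    (hF.continuous.mul hK.1.continuous).integrable_of_hasCompactSupport hK.2.mul_left
  have h2 : Integrable (fun y => F y * _root_.pd i K y) :=
    (hF.continuous.mul (hK.pd i).1.continuous).integrable_of_hasCompactSupport (hK.pd i).2.mul_left
  have h3 : Integrable (fun y => _root_.pd i F y * K y) :=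
    ((cd_pd hF i).continuous.mul hK.1.continuous).integrable_of_hasCompactSupport hK.2.mul_left
  have := integral_mul_fderiv_eq_neg_fderiv_mul_of_integrable h3 h2 h1
    (fun x _ => cdiff hF x) (fun x _ => hK.diff x)
  unfold _root_.pd at *
  rw [this]; simp

lemma TT_pd {F K : E2 → ℝ} (hF : ContDiff ℝ ((⊤ : ℕ∞) : WithTop ℕ∞) F) (hK : SC K) (i : Fin 2)
    (s : ℝ) (x : E2) :
    s * TT K s (_root_.pd i F) x = TT (_root_.pd i K) s F x := by
  have hc : ContDiff ℝ ((⊤ : ℕ∞) : WithTop ℕ∞) (fun y : E2 => F (x + (-s) • y)) :=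
    hF.comp (contDiff_const.add (contDiff_id.const_smul (-s)))
  have := ibp hc hK i
  simp only [pd_aff (cdiff hF)] at this
  unfold TT
  simp only [neg_smul, ← sub_eq_add_neg] at this
  rw [← neg_eq_iff_eq_neg] at this
  rw [← this, ← integral_const_mul, ← integral_neg]
  congr 1; funext y; ring

lemma TT_bound {F K : E2 → ℝ} {M : ℝ} (hF : ∀ x, |F x| ≤ M) (hK : SC K)
    (s : ℝ) (x : E2) : |TT K s F x| ≤ M * ∫ y, |K y| := by
  unfold TT
  rw [← integral_const_mul, ← Real.norm_eq_abs]
  apply norm_integral_le_of_norm_le (hK.int.abs.const_mul M)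
  filter_upwards with y
  rw [norm_mul, Real.norm_eq_abs, Real.norm_eq_abs]
  gcongr
  exact hF _

lemma par_deriv {F K : E2 → ℝ} (hF : SC F) (hK : SC K) {a b : E2 → E2} (ha : Continuous a)
    (hb : Continuous b) (t : ℝ) :
    HasDerivAt (fun t : ℝ => ∫ y, F (a y + t • b y) * K y)
      (∫ y, fderiv ℝ F (a y + t • b y) (b y) * K y) t := by
  obtain ⟨C, hC⟩ := (hF.2.fderiv (𝕜 := ℝ)).exists_bound_of_continuous
    (hF.1.continuous_fderiv (by simp))
  have hFc := hF.1.continuous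
  have hFd := hF.1.continuous_fderiv (by simp)
  have hKc := hK.1.continuous
  refine (hasDerivAt_integral_of_dominated_loc_of_deriv_le
    (F := fun t y => F (a y + t • b y) * K y)
    (F' := fun t y => fderiv ℝ F (a y + t • b y) (b y) * K y)
    (bound := fun y => C * ‖b y‖ * ‖K y‖) (s := Set.univ) Filter.univ_mem ?_ ?_ ?_ ?_ ?_ ?_).2
  · filter_upwards with s
    exact Continuous.aestronglyMeasurable (by fun_prop)
  · exact Continuous.integrable_of_hasCompactSupport (by fun_prop) hK.2.mul_left
  · refine Continuous.aestronglyMeasurable ?_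
    exact ((hFd.comp (by fun_prop)).clm_apply hb).mul hKc
  · filter_upwards with y s _
    rw [norm_mul]
    gcongr
    exact ((fderiv ℝ F (a y + s • b y)).le_opNorm _).trans (by gcongr; exact hC _)
  · exact Continuous.integrable_of_hasCompactSupport (by fun_prop) hK.2.norm.mul_left
  · filter_upwards with y s _
    have h1 : HasDerivAt (fun t : ℝ => a y + t • b y) (b y) s := by
      simpa using ((hasDerivAt_id s).smul_const (b y)).const_add (a y)
    have := (hF.diff (a y + s • b y)).hasFDerivAt.comp_hasDerivAt s h1
    exact this.mul_const _

lemma TT_cd {F K : E2 → ℝ} (hF : SC F) (hK : SC K) {s : ℝ} (hs : 0 < s) :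
    ContDiff ℝ ((⊤ : ℕ∞) : WithTop ℕ∞) (TT K s F) := by
  have hG : SC (fun y => F (s • y)) := by
    refine ⟨hF.1.comp (contDiff_id.const_smul s), ?_⟩
    exact hF.2.comp_homeomorph (Homeomorph.smulOfNeZero s hs.ne')
  have h1 := hG.2.contDiff_convolution_right (μ := volume) (ContinuousLinearMap.lsmul ℝ ℝ)
    hK.1.continuous.locallyIntegrable hG.1
  have h2 := h1.comp (contDiff_id.const_smul s⁻¹)
  convert h2 using 1
  funext x
  simp only [TT, Function.comp, convolution_def]
  congr 1; funext y
  simp [smul_sub, smul_smul, hs.ne', mul_comm]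

lemma pd_TT {F K : E2 → ℝ} (hF : SC F) (hK : SC K) {s : ℝ} (hs : 0 < s) (i : Fin 2) :
    _root_.pd i (TT K s F) = TT K s (_root_.pd i F) := by
  funext x
  have h := par_deriv hF hK (a := fun y => x - s • y) (b := fun _ => EuclideanSpace.single i 1)
    (by fun_prop) (by fun_prop) 0
  have h1 : HasDerivAt (fun t : ℝ => x + t • (EuclideanSpace.single i 1 : E2))
      (EuclideanSpace.single i 1) 0 := by
    simpa using ((hasDerivAt_id (0:ℝ)).smul_const (EuclideanSpace.single i 1 : E2)).const_add x
  have h2 := (cdiff (TT_cd hF hK hs) (x + (0:ℝ) • (EuclideanSpace.single i 1 : E2))).hasFDerivAt.comp_hasDerivAt 0 h1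
  have h3 : (TT K s F ∘ fun t : ℝ => x + t • (EuclideanSpace.single i 1 : E2)) =
    (fun t : ℝ => ∫ y, F (x - s • y + t • (EuclideanSpace.single i 1 : E2)) * K y) := by
    funext t; simp only [TT, Function.comp]
    congr 1; funext y; congr 2; abel
  rw [h3] at h2
  have := h2.unique h
  simp only [zero_smul, add_zero] at this
  exact this

lemma TT_deriv {F g k : E2 → ℝ} (hF : SC F) (hg : SC g) (hk : SC k)
    (hgk : ∀ i y, _root_.pd i k y = - (y i * g y)) (s : ℝ) (x : E2) :
    HasDerivAt (fun s => TT g s F x) (s * TT k s (_root_.lap F) x) s := by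
  have h := par_deriv hF hg (a := fun _ => x) (b := fun y => -y) (by fun_prop) (by fun_prop) s
  have e : (fun t : ℝ => ∫ y, F (x + t • -y) * g y) = (fun s => TT g s F x) := by
    funext t; simp [TT, sub_eq_add_neg]
  rw [e] at h
  convert h using 1
  have i1 : ∀ i : Fin 2, ∀ K, SC K → ∀ G, SC G → Integrable (fun y => G (x - s • y) * K y) := by
    intro i K hK G hG
    have := hK.1.continuous
    have := hG.1.continuous
    exact Continuous.integrable_of_hasCompactSupport (by fun_prop) hK.2.mul_left
  have e2 : TT k s (_root_.lap F) x = TT k s (_root_.pd 0 (_root_.pd 0 F)) x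
      + TT k s (_root_.pd 1 (_root_.pd 1 F)) x := by
    unfold TT
    rw [← integral_add (i1 0 _ hk _ ((hF.pd 0).pd 0)) (i1 0 _ hk _ ((hF.pd 1).pd 1))]
    congr 1; funext y; simp only [_root_.lap]; ring
  rw [e2, mul_add, TT_pd (hF.pd 0).1 hk, TT_pd (hF.pd 1).1 hk]
  unfold TT
  rw [← integral_add (i1 0 _ (hk.pd 0) _ ((hF.pd 0))) (i1 0 _ (hk.pd 1) _ ((hF.pd 1)))]
  congr 1; funext y
  rw [hgk, hgk]
  have hy : y = y 0 • (EuclideanSpace.single 0 1 : E2) + y 1 • (EuclideanSpace.single 1 1 : E2) := by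
    ext j; fin_cases j <;> simp
  have : fderiv ℝ F (x + s • -y) (-y) = -(y 0 * _root_.pd 0 F (x - s • y) + y 1 * _root_.pd 1 F (x - s • y)) := by
    have e : x + s • -y = x - s • y := by simp [sub_eq_add_neg]
    rw [e, map_neg]
    conv_lhs => rw [hy, map_add, map_smul, map_smul]
    simp only [_root_.pd, smul_eq_mul]
    rw [← hy]
  rw [this]; ring

lemma TT_lim {F K : E2 → ℝ} (hF : SC F) (hK : SC K) (x : E2) :
    Filter.Tendsto (fun s => TT K s F x) Filter.atTop (nhds 0) := by
  obtain ⟨C, hC⟩ := hK.2.exists_bound_of_continuous hK.1.continuous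
  have hb : ∀ s : ℝ, 0 < s → ‖TT K s F x‖ ≤ (s^2)⁻¹ * (C * ∫ y, ‖F (x - y)‖) := by
    intro s hs
    have h2 := Measure.integral_comp_smul (volume : Measure E2) (fun y => ‖F (x - y)‖) s
    have hi : Integrable (fun y => ‖F (x - s • y)‖) := by
      have : Integrable (fun y => ‖F (x - y)‖) := (hF.int.comp_sub_left x).norm
      exact this.comp_smul hs.ne'
    calc ‖TT K s F x‖ ≤ ∫ y, C * ‖F (x - s • y)‖ := by
          unfold TT
          apply norm_integral_le_of_norm_le (hi.const_mul C)
          filter_upwards with y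
          rw [norm_mul, mul_comm]
          gcongr; exact hC y
      _ = _ := by
          rw [integral_const_mul, h2]
          simp [abs_of_pos hs]
          ring
  rw [tendsto_zero_iff_norm_tendsto_zero]
  refine tendsto_of_tendsto_of_tendsto_of_le_of_le' tendsto_const_nhds
    (h := fun s : ℝ => (s^2)⁻¹ * (C * ∫ y, ‖F (x - y)‖)) ?_ ?_ ?_
  · have : Filter.Tendsto (fun s : ℝ => (s^2)⁻¹) Filter.atTop (nhds 0) :=
      tendsto_inv_atTop_zero.comp (Filter.tendsto_pow_atTop (by norm_num))
    simpa using this.mul_const (C * ∫ y, ‖F (x - y)‖)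
  · filter_upwards with s; positivity
  · filter_upwards [Filter.eventually_gt_atTop 0] with s hs using hb s hs

lemma kernel_exists : ∃ g k : E2 → ℝ, SC g ∧ SC k ∧ (∀ i y, pd i k y = - (y i * g y)) ∧
    ∫ y, g y = 1 := by
  have hst : ContDiff ℝ ((⊤ : ℕ∞) : WithTop ℕ∞) smoothTransition := smoothTransition.contDiff
  have hst' : ContDiff ℝ ((⊤ : ℕ∞) : WithTop ℕ∞) (deriv smoothTransition) := by
    have := (contDiff_infty_iff_deriv.1 hst).2
    exact this
  have hn : ContDiff ℝ ((⊤ : ℕ∞) : WithTop ℕ∞) (fun y : E2 => ‖y‖^2) := contDiff_norm_sq ℝ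
  set g0 : E2 → ℝ := fun y => 2 * deriv smoothTransition (‖y‖^2) with hg0
  set k0 : E2 → ℝ := fun y => 1 - smoothTransition (‖y‖^2) with hk0
  have hout : ∀ y : E2, y ∉ closedBall (0:E2) 1 → 1 < ‖y‖^2 := by
    intro y hy
    rw [mem_closedBall_zero_iff, not_le] at hy
    nlinarith
  have sg : SC g0 := by
    refine ⟨contDiff_const.mul (hst'.comp hn), ?_⟩
    refine HasCompactSupport.intro (isCompact_closedBall (0:E2) 1) ?_
    intro y hy
    have h1 : smoothTransition =ᶠ[nhds (‖y‖^2)] fun _ => 1 := by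
      filter_upwards [lt_mem_nhds (hout y hy)] with t ht
      exact smoothTransition.one_of_one_le ht.le
    simp [hg0, h1.deriv_eq]
  have sk : SC k0 := by
    refine ⟨contDiff_const.sub (hst.comp hn), ?_⟩
    refine HasCompactSupport.intro (isCompact_closedBall (0:E2) 1) ?_
    intro y hy
    simp [hk0, smoothTransition.one_of_one_le (hout y hy).le]
  have hgk : ∀ i y, pd i k0 y = - (y i * g0 y) := by
    intro i y
    have h1 : HasFDerivAt (fun y : E2 => ‖y‖^2) (2 • innerSL ℝ y) y :=
      (hasStrictFDerivAt_norm_sq y).hasFDerivAt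
    have h2 : HasDerivAt smoothTransition (deriv smoothTransition (‖y‖^2)) (‖y‖^2) :=
      (hst.differentiable (by simp) _).hasDerivAt
    have h3 := (h2.comp_hasFDerivAt y h1).const_sub 1
    unfold pd
    have e : k0 = fun x => 1 - (smoothTransition ∘ fun y : E2 => ‖y‖^2) x := rfl
    rw [e, h3.fderiv]
    simp [hg0, EuclideanSpace.inner_single_right]
    ring
  have hpos : 0 < ∫ y, g0 y := by
    obtain ⟨t, ht, ht'⟩ := exists_deriv_eq_slope smoothTransition (zero_lt_one)
      smoothTransition.continuous.continuousOn (hst.differentiable (by simp)).differentiableOn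
    refine sg.1.continuous.integral_pos_of_hasCompactSupport_nonneg_nonzero sg.2
      (x := √t • EuclideanSpace.single 0 1) ?_ ?_
    · intro y
      have : 0 ≤ deriv smoothTransition (‖y‖^2) := smoothTransition.monotone.deriv_nonneg
      simp only [hg0, Pi.zero_apply]; positivity
    · simp only [hg0, norm_smul, PiLp.norm_single, norm_one, mul_one, Real.norm_eq_abs,
        sq_abs, Real.sq_sqrt ht.1.le]
      rw [ht']; simp
  set c := ∫ y, g0 y with hc
  have smul : ∀ F : E2 → ℝ, SC F → SC (fun y => c⁻¹ * F y) := fun F hF =>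
    ⟨contDiff_const.mul hF.1, hF.2.mul_left⟩
  refine ⟨fun y => c⁻¹ * g0 y, fun y => c⁻¹ * k0 y, smul _ sg, smul _ sk, ?_, ?_⟩
  · intro i y
    have := pd_mul (F := fun _ => c⁻¹) (differentiable_const _) sk.diff i y
    rw [this, hgk]
    have : pd i (fun _ => c⁻¹) y = 0 := by simp [pd]
    rw [this]; ring
  · rw [integral_const_mul, ← hc, inv_mul_cancel₀ hpos.ne']

lemma tail_one {φ φ' : ℝ → ℝ} {K : ℝ} (hd : ∀ s, 0 < s → HasDerivAt φ (φ' s) s)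
    (hb : ∀ s, 0 < s → |φ' s| ≤ K / s^2) (hl : Filter.Tendsto φ Filter.atTop (nhds 0))
    {r : ℝ} (hr : 0 < r) : φ r ≤ K / r := by
  have hd2 : ∀ s, 0 < s → HasDerivAt (fun s => φ s - K * s⁻¹) (φ' s + K / s^2) s := by
    intro s hs
    have := (hd s hs).sub ((hasDerivAt_inv hs.ne').const_mul K)
    have e : φ' s - K * -(s ^ 2)⁻¹ = φ' s + K / s^2 := by rw [div_eq_mul_inv]; ring
    rw [e] at this
    exact this
  have hm : MonotoneOn (fun s => φ s - K * s⁻¹) (Set.Ioi 0) := by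
    apply monotoneOn_of_deriv_nonneg (convex_Ioi 0)
    · intro s hs; exact (hd2 s hs).continuousAt.continuousWithinAt
    · intro s hs
      rw [interior_Ioi] at hs
      exact (hd2 s hs).differentiableAt.differentiableWithinAt
    · intro s hs
      rw [interior_Ioi] at hs
      rw [(hd2 s hs).deriv]
      linarith [(abs_le.1 (hb s hs)).1]
  have hl2 : Filter.Tendsto (fun s => φ s - K * s⁻¹) Filter.atTop (nhds 0) := by
    simpa using hl.sub (tendsto_inv_atTop_zero.const_mul K)
  have : φ r - K * r⁻¹ ≤ 0 := by
    refine ge_of_tendsto hl2 ?_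
    filter_upwards [Filter.eventually_ge_atTop r] with s hs
    exact hm hr (hr.trans_le hs) hs
  rw [div_eq_mul_inv]; linarith

lemma tail {φ φ' : ℝ → ℝ} {K : ℝ} (hd : ∀ s, 0 < s → HasDerivAt φ (φ' s) s)
    (hb : ∀ s, 0 < s → |φ' s| ≤ K / s^2) (hl : Filter.Tendsto φ Filter.atTop (nhds 0))
    {r : ℝ} (hr : 0 < r) : |φ r| ≤ K / r := by
  rw [abs_le]
  have h1 := tail_one hd hb hl hr
  have h2 := tail_one (φ := fun s => - φ s) (φ' := fun s => - φ' s) (K := K)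
    (fun s hs => (hd s hs).neg) (fun s hs => by rw [abs_neg]; exact hb s hs)
    (by simpa using hl.neg) hr
  constructor <;> linarith

section
variable {g k : E2 → ℝ} (hg : SC g) (hk : SC k) (hgk : ∀ i y, pd i k y = - (y i * g y))
  (hg1 : ∫ y, g y = 1) {h : E2 → ℝ} (hh : SC h) {M : ℝ} (hM : ∀ x, |lap h x| ≤ M)

lemma far3 (hg : SC g) (hk : SC k) (hgk : ∀ i y, pd i k y = - (y i * g y)) (hh : SC h)
    (hM : ∀ x, |lap h x| ≤ M) (j : Fin 2) {r : ℝ} (hr : 0 < r) (x : E2) :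
    |TT g r (pd j (pd 0 (pd 1 h))) x| ≤ M * (∫ y, |pd 1 (pd 0 (pd j k)) y|) / r := by
  have h1 := (hh.pd 1)
  have h0 := h1.pd 0
  have hj := h0.pd j
  refine tail (φ := fun s => TT g s (pd j (pd 0 (pd 1 h))) x)
    (fun s _ => TT_deriv hj hg hk hgk s x) ?_ (TT_lim hj hg x) hr
  intro s hs
  rw [lap_pd h0, lap_pd h1, lap_pd hh]
  have hb := TT_bound hM (((hk.pd j).pd 0).pd 1) s x
  rw [← TT_pd hh.lap.1 ((hk.pd j).pd 0), ← TT_pd (hh.lap.pd 1).1 (hk.pd j),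
    ← TT_pd ((hh.lap.pd 1).pd 0).1 hk] at hb
  rw [le_div_iff₀ (by positivity), ← abs_of_pos (show 0 < s^2 by positivity), ← abs_mul]
  refine le_trans (le_of_eq ?_) hb
  congr 1; ring

lemma TT_zero (hg1 : ∫ y, g y = 1) (F : E2 → ℝ) (x : E2) : TT g 0 F x = F x := by
  simp [TT, integral_const_mul, hg1]

lemma near0 (hg : SC g) (hk : SC k) (hgk : ∀ i y, pd i k y = - (y i * g y))
    (hg1 : ∫ y, g y = 1) (hh : SC h)
    (hM : ∀ x, |lap h x| ≤ M) {r : ℝ} (hr : 0 < r) (x : E2) :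
    |h x - TT g r h x| ≤ M * (∫ y, |k y|) * r^2 := by
  have := norm_image_sub_le_of_norm_deriv_le_segment' (f := fun s => TT g s h x) (a := 0) (b := r)
    (C := r * (M * ∫ y, |k y|))
    (fun s _ => (TT_deriv hh hg hk hgk s x).hasDerivWithinAt) ?_ r ⟨hr.le, le_rfl⟩
  · rw [TT_zero hg1, Real.norm_eq_abs, abs_sub_comm] at this
    linarith
  · intro s hs
    rw [norm_mul, Real.norm_eq_abs, Real.norm_eq_abs, abs_of_nonneg hs.1]
    have := TT_bound hM hk s x
    gcongr
    exact hs.2.le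

lemma near1 (hg : SC g) (hk : SC k) (hgk : ∀ i y, pd i k y = - (y i * g y))
    (hg1 : ∫ y, g y = 1) (hh : SC h)
    (hM : ∀ x, |lap h x| ≤ M) (i : Fin 2) {r : ℝ} (hr : 0 < r) (x : E2) :
    |pd i h x - TT g r (pd i h) x| ≤ M * (∫ y, |pd i k y|) * r := by
  have := norm_image_sub_le_of_norm_deriv_le_segment' (f := fun s => TT g s (pd i h) x)
    (a := 0) (b := r) (C := (M * ∫ y, |pd i k y|))
    (fun s _ => (TT_deriv (hh.pd i) hg hk hgk s x).hasDerivWithinAt) ?_ r ⟨hr.le, le_rfl⟩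
  · rw [TT_zero hg1, Real.norm_eq_abs, abs_sub_comm] at this
    linarith
  · intro s hs
    rw [lap_pd hh, TT_pd hh.lap.1 hk]
    exact TT_bound hM (hk.pd i) s x
end

lemma pd_congr {F G : E2 → ℝ} {x : E2} (h : F =ᶠ[nhds x] G) (i : Fin 2) :
    pd i F =ᶠ[nhds x] pd i G := by
  filter_upwards [h.fderiv (𝕜 := ℝ)] with y hy
  simp [pd, hy]

lemma L2 {u : E2 → ℝ} (hu : SC u) : ∫ x, (pd 0 (pd 1 u) x)^2 ≤ (1/4) * ∫ x, (lap u x)^2 := by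
  have e1 := ibp (hu.pd 1).1 ((hu.pd 1).pd 0) 0
  have e2 := ibp (hu.pd 1).1 ((hu.pd 0).pd 0) 1
  have e3 : pd 1 (pd 0 (pd 0 u)) = pd 0 (pd 0 (pd 1 u)) := by
    rw [pd_comm (hu.pd 0).1 1 0, pd_comm hu.1 1 0]
  rw [e3, ← e1] at e2
  have e4 : ∫ x, (pd 0 (pd 1 u) x)^2 = ∫ x, pd 1 (pd 1 u) x * pd 0 (pd 0 u) x := by
    rw [e2]; congr 1; funext x; ring
  rw [e4, ← integral_const_mul]
  have c0 := ((hu.pd 0).pd 0)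
  have c1 := ((hu.pd 1).pd 1)
  apply integral_mono
  · exact (c1.1.continuous.mul c0.1.continuous).integrable_of_hasCompactSupport c0.2.mul_left
  · have := hu.lap.1.continuous
    refine Continuous.integrable_of_hasCompactSupport (by fun_prop) ?_
    have h2 : HasCompactSupport (fun x => lap u x * lap u x) := hu.lap.2.mul_left
    simp only [pow_two]
    exact h2.mul_left
  · intro x
    simp only [lap]
    nlinarith [sq_nonneg (pd 0 (pd 0 u) x - pd 1 (pd 1 u) x)]

lemma lap_mul {F G : E2 → ℝ} (hF : ContDiff ℝ ((⊤ : ℕ∞) : WithTop ℕ∞) F)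
    (hG : ContDiff ℝ ((⊤ : ℕ∞) : WithTop ℕ∞) G) (x : E2) :
    lap (fun x => F x * G x) x = F x * lap G x + 2 * (pd 0 F x * pd 0 G x + pd 1 F x * pd 1 G x)
      + G x * lap F x := by
  have key : ∀ i, pd i (pd i (fun x => F x * G x)) x =
      F x * pd i (pd i G) x + 2 * (pd i F x * pd i G x) + G x * pd i (pd i F) x := by
    intro i
    have e : pd i (fun x => F x * G x) = fun x => F x * pd i G x + G x * pd i F x :=
      funext (pd_mul (cdiff hF) (cdiff hG) i)
    have dF := cdiff hF
    have dG := cdiff hG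
    have dF' := cdiff (cd_pd hF i)
    have dG' := cdiff (cd_pd hG i)
    rw [e, pd_add (dF.fun_mul dG') (dG.fun_mul dF'), pd_mul dF dG', pd_mul dG dF']
    ring
  simp only [lap] at *
  rw [key, key]; ring

lemma osc_le {F : E2 → ℝ} (hF : Continuous F) (c : ℝ) (z : E2) {r : ℝ} (hr : 0 < r) :
    (π * r ^ 2)⁻¹ * (∫ x in closedBall z r,
            |F x - (π * r ^ 2)⁻¹ * (∫ y in closedBall z r, F y)|) ≤
    2 * ((π * r ^ 2)⁻¹ * ∫ x in closedBall z r, |F x - c|) := by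
  have hv : volume.real (closedBall z r) = π * r^2 := by
    rw [Measure.real, EuclideanSpace.volume_closedBall_fin_two]
    simp [ENNReal.toReal_mul, ENNReal.toReal_ofReal, hr.le, pi_pos.le, mul_comm]
  have hK := isCompact_closedBall z r
  have hi : ∀ G : E2 → ℝ, Continuous G → IntegrableOn G (closedBall z r) :=
    fun G hG => hG.continuousOn.integrableOn_compact hK
  set V := π * r^2 with hV
  have hVp : 0 < V := by positivity
  set a := V⁻¹ * (∫ y in closedBall z r, F y) with ha
  have h1 : |c - a| * V ≤ ∫ x in closedBall z r, |F x - c| := by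
    have : ∫ x in closedBall z r, (F x - c) = (a - c) * V := by
      rw [integral_sub (hi _ hF) (hi _ continuous_const), setIntegral_const, hv, ha, smul_eq_mul]
      field_simp
    calc |c - a| * V = |∫ x in closedBall z r, (F x - c)| := by
          rw [this, abs_mul, abs_of_pos hVp, abs_sub_comm]
      _ ≤ _ := abs_integral_le_integral_abs
  have h2 : ∫ x in closedBall z r, |F x - a| ≤ ∫ x in closedBall z r, (|F x - c| + |c - a|) := by
    apply setIntegral_mono (hi _ (by fun_prop)) (hi _ (by fun_prop))
    intro x; exact abs_sub_le _ _ _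
  rw [integral_add (hi _ (by fun_prop)) (hi _ (by fun_prop)), setIntegral_const, hv, smul_eq_mul] at h2
  rw [mul_left_comm]
  gcongr
  linarith

lemma cutoff : ∃ b : E2 → ℝ, ∃ B : ℝ, 0 ≤ B ∧ SC b ∧ (∀ x, |b x| ≤ 1) ∧ (∀ i x, |pd i b x| ≤ B) ∧
    (∀ x, |lap b x| ≤ B) ∧ (∀ x, ‖x‖ < 2 → b x = 1) ∧ (∀ x, 3 < ‖x‖ → b x = 0) := by
  let b : ContDiffBump (0:E2) := ⟨2, 3, by norm_num, by norm_num⟩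
  have hb : SC b := ⟨b.contDiff, b.hasCompactSupport⟩
  obtain ⟨B0, h0⟩ := (hb.pd 0).2.exists_bound_of_continuous (hb.pd 0).1.continuous
  obtain ⟨B1, h1⟩ := (hb.pd 1).2.exists_bound_of_continuous (hb.pd 1).1.continuous
  obtain ⟨B2, h2⟩ := hb.lap.2.exists_bound_of_continuous hb.lap.1.continuous
  refine ⟨b, |B0| + |B1| + |B2|, by positivity, hb, ?_, ?_, ?_, ?_, ?_⟩
  · intro x; rw [abs_of_nonneg b.nonneg]; exact b.le_one
  · intro i x
    fin_cases i
    · exact (h0 x).trans (by linarith [le_abs_self B0, abs_nonneg B1, abs_nonneg B2])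
    · exact (h1 x).trans (by linarith [le_abs_self B1, abs_nonneg B0, abs_nonneg B2])
  · intro x
    exact (h2 x).trans (by linarith [le_abs_self B2, abs_nonneg B0, abs_nonneg B1])
  · intro x hx
    exact b.one_of_mem_closedBall (by simpa using hx.le)
  · intro x hx
    exact b.zero_of_le_dist (by simpa using hx.le)

lemma vol_ball (z : E2) {r : ℝ} (hr : 0 < r) : volume.real (closedBall z r) = π * r^2 := by
  rw [Measure.real, EuclideanSpace.volume_closedBall_fin_two]
  simp [ENNReal.toReal_mul, ENNReal.toReal_ofReal, hr.le, pi_pos.le, mul_comm]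

lemma local_est : ∃ g k : E2 → ℝ, SC g ∧ SC k ∧ (∀ i y, pd i k y = - (y i * g y)) ∧
    ∃ Q : ℝ, 0 ≤ Q ∧ ∀ h : E2 → ℝ, SC h → ∀ M : ℝ, 0 < M → (∀ x, |lap h x| ≤ M) →
      ∀ (z : E2) (r : ℝ), 0 < r →
      ∫ x in closedBall z r, |pd 0 (pd 1 h) x - TT g r (pd 0 (pd 1 h)) x| ≤ Q * M * (π * r^2) := by
  obtain ⟨g, k, hg, hk, hgk, hg1⟩ := kernel_exists
  obtain ⟨b, B, hB, hb, hb0, hb1, hb2, hbin, hbout⟩ := cutoff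
  refine ⟨g, k, hg, hk, hgk, ?_⟩
  set G := ∫ y, |g y| with hG
  set K := ∫ y, |k y| with hK
  set K0 := ∫ y, |pd 0 k y| with hK0
  set K1 := ∫ y, |pd 1 k y| with hK1
  have pG : 0 ≤ G := integral_nonneg fun _ => abs_nonneg _
  have pK : 0 ≤ K := integral_nonneg fun _ => abs_nonneg _
  have pK0 : 0 ≤ K0 := integral_nonneg fun _ => abs_nonneg _
  have pK1 : 0 ≤ K1 := integral_nonneg fun _ => abs_nonneg _
  set P := (1 + G) + 2 * (B * K0 + B * K1) + K * B with hP
  have pP : 0 ≤ P := by positivity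
  refine ⟨1 + (9/4) * P^2, by positivity, ?_⟩
  intro h hh M hM hlap z r hr
  set w : E2 → ℝ := fun x => h x - TT g r h x with hw
  have cT := TT_cd hh hg hr
  have cw : ContDiff ℝ ((⊤ : ℕ∞) : WithTop ℕ∞) w := hh.1.sub cT
  have pw : ∀ i, pd i w = fun x => pd i h x - TT g r (pd i h) x := by
    intro i; funext x
    rw [hw, pd_sub hh.diff (cdiff cT), pd_TT hh hg hr]
  have ppw : ∀ i j, pd i (pd j w) = fun x => pd i (pd j h) x - TT g r (pd i (pd j h)) x := by
    intro i j; funext x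
    rw [pw, pd_sub (hh.pd j).diff (cdiff (TT_cd (hh.pd j) hg hr)), pd_TT (hh.pd j) hg hr]
  have bw : ∀ x, |w x| ≤ M * K * r^2 := near0 hg hk hgk hg1 hh hlap hr
  have bw0 : ∀ x, |pd 0 w x| ≤ M * K0 * r := by
    intro x; rw [pw]; exact near1 hg hk hgk hg1 hh hlap 0 hr x
  have bw1 : ∀ x, |pd 1 w x| ≤ M * K1 * r := by
    intro x; rw [pw]; exact near1 hg hk hgk hg1 hh hlap 1 hr x
  have bwl : ∀ x, |lap w x| ≤ M * (1 + G) := by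
    intro x
    have e : lap w x = lap h x - TT g r (lap h) x := by
      have e2 : lap (TT g r h) x = TT g r (lap h) x := by
        have i1 : ∀ F, SC F → Integrable (fun y => F (x - r • y) * g y) := by
          intro F hF
          have := hg.1.continuous
          have := hF.1.continuous
          exact Continuous.integrable_of_hasCompactSupport (by fun_prop) hg.2.mul_left
        simp only [lap]
        rw [pd_TT hh hg hr, pd_TT hh hg hr, pd_TT (hh.pd 0) hg hr, pd_TT (hh.pd 1) hg hr]
        unfold TT
        rw [← integral_add (i1 _ ((hh.pd 0).pd 0)) (i1 _ ((hh.pd 1).pd 1))]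
        congr 1; funext y; simp only [lap]; ring
      rw [← e2]
      simp only [lap]
      rw [ppw, ppw, pd_TT hh hg hr, pd_TT hh hg hr, pd_TT (hh.pd 0) hg hr, pd_TT (hh.pd 1) hg hr]
      ring
    rw [e]
    have := TT_bound hlap hg r x
    calc _ ≤ |lap h x| + |TT g r (lap h) x| := abs_sub _ _
      _ ≤ M + M * G := add_le_add (hlap x) this
      _ = _ := by ring
  set a : E2 := -(r⁻¹ • z) with ha
  have hax : ∀ x, a + r⁻¹ • x = r⁻¹ • (x - z) := by intro x; rw [ha, smul_sub]; abel
  have hnx : ∀ x, ‖a + r⁻¹ • x‖ = dist x z / r := by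
    intro x; rw [hax, norm_smul, norm_inv, Real.norm_eq_abs, abs_of_pos hr, dist_eq_norm]; field_simp
  set η : E2 → ℝ := fun x => b (a + r⁻¹ • x) with hη
  have cη : ContDiff ℝ ((⊤ : ℕ∞) : WithTop ℕ∞) η :=
    hb.1.comp (contDiff_const.add (contDiff_id.const_smul r⁻¹))
  have pη : ∀ i, pd i η = fun x => r⁻¹ * pd i b (a + r⁻¹ • x) :=
    fun i => funext fun x => pd_aff hb.diff i a r⁻¹ x
  have ppη : ∀ i x, pd i (pd i η) x = r⁻¹ * (r⁻¹ * pd i (pd i b) (a + r⁻¹ • x)) := by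
    intro i x
    have d1 : Differentiable ℝ (fun x => pd i b (a + r⁻¹ • x)) :=
      (hb.pd i).diff.comp ((differentiable_const _).add (differentiable_id.const_smul r⁻¹))
    have := pd_mul (F := fun _ => r⁻¹) (differentiable_const _) d1 i x
    rw [pη, this, pd_aff (hb.pd i).diff]
    have : pd i (fun _ => r⁻¹) x = 0 := by simp [pd]
    rw [this]; ring
  have bη : ∀ x, |η x| ≤ 1 := fun x => hb0 _
  have bη1 : ∀ i x, |pd i η x| ≤ B / r := by
    intro i x
    rw [pη, abs_mul, abs_of_pos (inv_pos.2 hr), div_eq_inv_mul]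
    gcongr; exact hb1 _ _
  have bηl : ∀ x, |lap η x| ≤ B / r^2 := by
    intro x
    have : lap η x = (r^2)⁻¹ * lap b (a + r⁻¹ • x) := by
      simp only [lap]; rw [ppη, ppη]; field_simp
    rw [this, abs_mul, abs_of_pos (by positivity : 0 < (r^2)⁻¹), div_eq_inv_mul]
    gcongr; exact hb2 _
  set u : E2 → ℝ := fun x => η x * w x with hu
  have zero_out : ∀ x, x ∉ closedBall z (3*r) → η x = 0 := by
    intro x hx
    rw [mem_closedBall, not_le] at hx
    apply hbout
    rw [hnx, lt_div_iff₀ hr]; exact hx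
  have su : SC u := by
    refine ⟨cη.mul cw, HasCompactSupport.intro (isCompact_closedBall z (3*r)) ?_⟩
    intro x hx; simp [hu, zero_out x hx]
  have lu_out : ∀ x, x ∉ closedBall z (3*r) → lap u x = 0 := by
    intro x hx
    have h0 : u =ᶠ[nhds x] fun _ => 0 := by
      filter_upwards [isClosed_closedBall.isOpen_compl.mem_nhds hx] with y hy
      simp [hu, zero_out y hy]
    have z0 : ∀ i, pd i (fun _ : E2 => (0:ℝ)) = fun _ => 0 := by
      intro i; funext y; simp [pd]
    simp only [lap]
    rw [(pd_congr (pd_congr h0 0) 0).eq_of_nhds, (pd_congr (pd_congr h0 1) 1).eq_of_nhds,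
      z0, z0, z0, z0]
    simp
  have bu : ∀ x, |lap u x| ≤ M * P := by
    intro x
    rw [hu, lap_mul cη cw]
    have t1 : |η x * lap w x| ≤ 1 * (M * (1 + G)) := by
      rw [abs_mul]; exact mul_le_mul (bη x) (bwl x) (abs_nonneg _) zero_le_one
    have t2 : |pd 0 η x * pd 0 w x| ≤ (B / r) * (M * K0 * r) := by
      rw [abs_mul]; exact mul_le_mul (bη1 0 x) (bw0 x) (abs_nonneg _) (by positivity)
    have t3 : |pd 1 η x * pd 1 w x| ≤ (B / r) * (M * K1 * r) := by
      rw [abs_mul]; exact mul_le_mul (bη1 1 x) (bw1 x) (abs_nonneg _) (by positivity)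
    have t4 : |w x * lap η x| ≤ (M * K * r^2) * (B / r^2) := by
      rw [abs_mul]; exact mul_le_mul (bw x) (bηl x) (abs_nonneg _) (by positivity)
    have e2 : (B / r) * (M * K0 * r) = M * (B * K0) := by field_simp
    have e3 : (B / r) * (M * K1 * r) = M * (B * K1) := by field_simp
    have e4 : (M * K * r^2) * (B / r^2) = M * (K * B) := by field_simp
    rw [e2] at t2; rw [e3] at t3; rw [e4] at t4
    rw [abs_le] at *
    constructor <;> rw [hP] <;> nlinarith
  have I1 : ∫ x, (lap u x)^2 ≤ (M * P)^2 * (9 * (π * r^2)) := by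
    rw [← setIntegral_eq_integral_of_forall_compl_eq_zero (s := closedBall z (3*r))
      (fun x hx => by rw [lu_out x hx]; simp)]
    have hc := su.lap.1.continuous
    calc _ ≤ ∫ x in closedBall z (3*r), (M * P)^2 := by
          apply setIntegral_mono
            ((by fun_prop : Continuous (fun x => lap u x ^2)).continuousOn.integrableOn_compact
              (isCompact_closedBall z (3*r)))
            (continuousOn_const.integrableOn_compact (isCompact_closedBall z (3*r)))
          intro x
          exact sq_le_sq' (abs_le.1 (bu x)).1 (abs_le.1 (bu x)).2
      _ = _ := by
          rw [setIntegral_const, vol_ball z (by positivity), smul_eq_mul]; ring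
  have hc12 : Continuous (pd 0 (pd 1 u)) := ((su.pd 1).pd 0).1.continuous
  have hsq : Integrable (fun x => (pd 0 (pd 1 u) x)^2) := by
    refine Continuous.integrable_of_hasCompactSupport (by fun_prop) ?_
    simp only [pow_two]
    exact ((su.pd 1).pd 0).2.mul_left
  have heq : ∀ x ∈ closedBall z r, |pd 0 (pd 1 h) x - TT g r (pd 0 (pd 1 h)) x| =
      |pd 0 (pd 1 u) x| := by
    intro x hx
    have h0 : u =ᶠ[nhds x] w := by
      have : x ∈ ball z (2*r) := by
        rw [mem_ball]; rw [mem_closedBall] at hx; linarith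
      filter_upwards [isOpen_ball.mem_nhds this] with y hy
      have : η y = 1 := by
        apply hbin; rw [hnx, div_lt_iff₀ hr]; exact hy
      simp [hu, this]
    rw [(pd_congr (pd_congr h0 1) 0).eq_of_nhds, ppw]
  rw [setIntegral_congr_fun measurableSet_closedBall heq]
  calc _ ≤ ∫ x in closedBall z r, (M + M⁻¹ * (pd 0 (pd 1 u) x)^2) := by
        apply setIntegral_mono
          (hc12.abs.continuousOn.integrableOn_compact (isCompact_closedBall z r))
          ((by fun_prop : Continuous (fun x => M + M⁻¹ * (pd 0 (pd 1 u) x)^2)).continuousOn.integrableOn_compact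
            (isCompact_closedBall z r))
        intro x
        change |pd 0 (pd 1 u) x| ≤ M + M⁻¹ * (pd 0 (pd 1 u) x)^2
        rw [← sq_abs]
        set t := |pd 0 (pd 1 u) x| with ht
        have : M + M⁻¹ * t^2 - t = M⁻¹ * ((M - t)^2 + M * t) := by field_simp; ring
        have : 0 ≤ M⁻¹ * ((M - t)^2 + M * t) := by positivity
        linarith
    _ = M * (π * r^2) + M⁻¹ * ∫ x in closedBall z r, (pd 0 (pd 1 u) x)^2 := by
        rw [integral_add (continuousOn_const.integrableOn_compact (isCompact_closedBall z r))
          (hsq.integrableOn.const_mul _), setIntegral_const, vol_ball z hr, integral_const_mul,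
          smul_eq_mul, mul_comm]
    _ ≤ M * (π * r^2) + M⁻¹ * ∫ x, (pd 0 (pd 1 u) x)^2 := by
        gcongr
        · filter_upwards with x; positivity
        · exact Measure.restrict_le_self
    _ ≤ M * (π * r^2) + M⁻¹ * ((1/4) * ((M * P)^2 * (9 * (π * r^2)))) := by
        gcongr
        exact (L2 su).trans (by gcongr)
    _ = _ := by field_simp

lemma main_est : ∃ C : ℝ, 0 < C ∧ ∀ h : E2 → ℝ, SC h → ∀ M : ℝ, 0 < M → (∀ x, |lap h x| ≤ M) →
      ∀ (z : E2) (r : ℝ), 0 < r →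
        (π * r ^ 2)⁻¹ * (∫ x in closedBall z r,
            |pd 0 (pd 1 h) x -
              (π * r ^ 2)⁻¹ * (∫ y in closedBall z r, pd 0 (pd 1 h) y)|) ≤ C * M := by
  obtain ⟨g, k, hg, hk, hgk, Q, hQ, hloc⟩ := local_est
  set R0 := ∫ y, |pd 1 (pd 0 (pd 0 k)) y| with hR0
  set R1 := ∫ y, |pd 1 (pd 0 (pd 1 k)) y| with hR1
  have pR0 : 0 ≤ R0 := integral_nonneg fun _ => abs_nonneg _
  have pR1 : 0 ≤ R1 := integral_nonneg fun _ => abs_nonneg _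
  refine ⟨2 * (Q + (R0 + R1)) + 1, by positivity, ?_⟩
  intro h hh M hM hlap z r hr
  have hF := (hh.pd 1).pd 0
  set F := pd 0 (pd 1 h) with hFdef
  set A := TT g r F with hA
  have cA : ContDiff ℝ ((⊤ : ℕ∞) : WithTop ℕ∞) A := TT_cd hF hg hr
  have hfd : ∀ x, ‖fderiv ℝ A x‖ ≤ M * (R0 + R1) / r := by
    intro x
    apply ContinuousLinearMap.opNorm_le_bound _ (by positivity)
    intro y
    have hy : y = y 0 • (EuclideanSpace.single 0 1 : E2) + y 1 • (EuclideanSpace.single 1 1 : E2) := by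
      ext j; fin_cases j <;> simp
    have e : fderiv ℝ A x y = y 0 * pd 0 A x + y 1 * pd 1 A x := by
      conv_lhs => rw [hy, map_add, map_smul, map_smul]
      simp only [pd, smul_eq_mul]
    have b0 : |pd 0 A x| ≤ M * R0 / r := by
      rw [hA, pd_TT hF hg hr]; exact far3 hg hk hgk hh hlap 0 hr x
    have b1 : |pd 1 A x| ≤ M * R1 / r := by
      rw [hA, pd_TT hF hg hr]; exact far3 hg hk hgk hh hlap 1 hr x
    have n0 : |y 0| ≤ ‖y‖ := PiLp.norm_apply_le y 0
    have n1 : |y 1| ≤ ‖y‖ := PiLp.norm_apply_le y 1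
    rw [e, Real.norm_eq_abs]
    calc _ ≤ |y 0| * |pd 0 A x| + |y 1| * |pd 1 A x| := by
          rw [← abs_mul, ← abs_mul]; exact abs_add_le _ _
      _ ≤ ‖y‖ * (M * R0 / r) + ‖y‖ * (M * R1 / r) := by gcongr
      _ = _ := by ring
  have hosc : ∀ x ∈ closedBall z r, |A x - A z| ≤ M * (R0 + R1) := by
    intro x hx
    have := Convex.norm_image_sub_le_of_norm_fderiv_le (𝕜 := ℝ) (f := A) (s := Set.univ)
      (fun x _ => cdiff cA x) (fun x _ => hfd x) convex_univ (Set.mem_univ z) (Set.mem_univ x)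
    rw [mem_closedBall, dist_eq_norm] at hx
    rw [Real.norm_eq_abs] at this
    calc _ ≤ _ := this
      _ ≤ M * (R0 + R1) / r * r := by gcongr
      _ = _ := by field_simp
  have cF := hF.1.continuous
  have cA' := cA.continuous
  have hi : ∀ G : E2 → ℝ, Continuous G → IntegrableOn G (closedBall z r) :=
    fun G hG => hG.continuousOn.integrableOn_compact (isCompact_closedBall z r)
  have hI : ∫ x in closedBall z r, |F x - A z| ≤ (Q + (R0 + R1)) * M * (π * r^2) := by
    calc _ ≤ ∫ x in closedBall z r, (|F x - A x| + M * (R0 + R1)) := by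
          apply setIntegral_mono_on (hi _ (by fun_prop)) (hi _ (by fun_prop))
            measurableSet_closedBall
          intro x hx
          linarith [abs_sub_le (F x) (A x) (A z), hosc x hx]
      _ = (∫ x in closedBall z r, |F x - A x|) + M * (R0 + R1) * (π * r^2) := by
          rw [integral_add (hi _ (by fun_prop)) (hi _ (by fun_prop)), setIntegral_const,
            vol_ball z hr, smul_eq_mul]; ring
      _ ≤ Q * M * (π * r^2) + M * (R0 + R1) * (π * r^2) := by
          gcongr; exact hloc h hh M hM hlap z r hr
      _ = _ := by ring
  have hV : 0 < π * r^2 := by positivity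
  refine (osc_le cF (A z) z hr).trans ?_
  calc _ ≤ 2 * ((π * r^2)⁻¹ * ((Q + (R0 + R1)) * M * (π * r^2))) := by gcongr
    _ = 2 * (Q + (R0 + R1)) * M := by field_simp
    _ ≤ _ := by nlinarith

/-- The mean oscillation of `∂₁∂₂h` over any disk is controlled by `sup |Δh|`. -/
theorem stmt_6 : ∃ C : ℝ, 0 < C ∧
    ∀ h : EuclideanSpace ℝ (Fin 2) → ℝ,
      ContDiff ℝ ((⊤ : ℕ∞) : WithTop ℕ∞) h → HasCompactSupport h →
      ∀ (z : EuclideanSpace ℝ (Fin 2)) (r : ℝ), 0 < r →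
        (π * r ^ 2)⁻¹ * (∫ x in closedBall z r,
            |pd 0 (pd 1 h) x -
              (π * r ^ 2)⁻¹ * (∫ y in closedBall z r, pd 0 (pd 1 h) y)|) ≤
          C * ⨆ x, |pd 0 (pd 0 h) x + pd 1 (pd 1 h) x| := by
  obtain ⟨C, hC, hmain⟩ := main_est
  refine ⟨C, hC, ?_⟩
  intro h h1 h2 z r hr
  have hh : SC h := ⟨h1, h2⟩
  obtain ⟨B, hB⟩ := hh.lap.2.exists_bound_of_continuous hh.lap.1.continuous
  have hbdd : BddAbove (Set.range fun x => |pd 0 (pd 0 h) x + pd 1 (pd 1 h) x|) :=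
    ⟨B, by rintro _ ⟨x, rfl⟩; exact hB x⟩
  set S := ⨆ x, |pd 0 (pd 0 h) x + pd 1 (pd 1 h) x| with hS
  have hle : ∀ x, |lap h x| ≤ S := fun x => le_ciSup hbdd x
  have hS0 : 0 ≤ S := (abs_nonneg _).trans (hle 0)
  rw [← div_le_iff₀' hC]
  apply le_of_forall_pos_le_add
  intro ε hε
  rw [div_le_iff₀' hC]
  exact hmain h hh (S + ε) (by positivity) (fun x => (hle x).trans (by linarith)) z r hr
end

section
/- Let n ≥ 3 be an integer, let U be an open subset of ℝⁿ, and let F be a closed subset of ℝⁿ whose Hausdorff dimension is strictly less than n − 2. Then every continuous loop γ : S¹ → U \ F whose composition with the inclusion U \ F ↪ U is null-homotopic in U is already null-homotopic in U \ F. In particular, the complement ℝⁿ \ F is a simply connected topological space. -/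
open Metric
open scoped ENNReal

section Helpers

open MeasureTheory MeasureTheory.Measure Filter Topology
open scoped NNReal

theorem cover_aux {X : Type*} [EMetricSpace X] [MeasurableSpace X] [BorelSpace X]
    {d : ℝ} (hd : 0 < d) {F : Set X} (hF : μH[d] F = 0) (r : ℝ≥0) (hr : 0 < r) (ε : ℝ≥0∞)
    (hε : ε ≠ 0) :
    ∃ (t : ℕ → Set X) (ρ : ℕ → ℝ≥0), F ⊆ ⋃ i, t i ∧ (∀ i, ediam (t i) ≤ ρ i) ∧
      (∀ i, 0 < ρ i) ∧ (∀ i, ρ i ≤ r) ∧ ∑' i, (ρ i : ℝ≥0∞) ^ d ≤ ε := by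
  have hε2 : ε / 2 ≠ 0 := by simpa using hε
  obtain ⟨e, he0, he⟩ := ENNReal.exists_pos_sum_of_countable hε2 ℕ
  rw [hausdorffMeasure_apply] at hF
  have h1 := (iSup₂_le_iff.1 hF.le) r (by simpa using hr)
  have h2 := lt_of_le_of_lt h1 (pos_iff_ne_zero.2 hε2)
  simp only [iInf_lt_iff] at h2
  obtain ⟨t, ht, htr, hs⟩ := h2
  refine ⟨t, fun i => max (ediam (t i)).toNNReal (min r (e i ^ (1/d))), ht, ?_, ?_, ?_, ?_⟩
  · intro i
    have : ediam (t i) ≠ ∞ := ne_top_of_le_ne_top ENNReal.coe_ne_top (htr i)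
    rw [ENNReal.coe_max, ENNReal.coe_toNNReal this]
    exact le_max_left _ _
  · intro i
    refine lt_max_of_lt_right (lt_min hr (NNReal.rpow_pos (he0 i)))
  · intro i
    refine max_le ?_ (min_le_left _ _)
    exact (ENNReal.toNNReal_mono ENNReal.coe_ne_top (htr i)).trans_eq (ENNReal.toNNReal_coe _)
  · have key : ∀ i, ((max (ediam (t i)).toNNReal (min r (e i ^ (1/d))) : ℝ≥0) : ℝ≥0∞) ^ d ≤
      (⨆ _ : (t i).Nonempty, ediam (t i) ^ d) + e i := by
      intro i
      have hne : ediam (t i) ≠ ∞ := ne_top_of_le_ne_top ENNReal.coe_ne_top (htr i)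
      rcases le_total (ediam (t i)).toNNReal (min r (e i ^ (1/d))) with h | h
      · rw [max_eq_right h]
        refine le_trans ?_ (le_add_self)
        calc ((min r (e i ^ (1/d)) : ℝ≥0) : ℝ≥0∞) ^ d ≤ ((e i ^ (1/d) : ℝ≥0) : ℝ≥0∞) ^ d := by
              gcongr
              exact min_le_right _ _
          _ = e i := by
              rw [← ENNReal.coe_rpow_of_nonneg _ hd.le, ← NNReal.rpow_mul]
              simp [hd.ne']
      · rw [max_eq_left h, ENNReal.coe_toNNReal hne]
        refine le_trans ?_ (le_self_add)
        rcases (t i).eq_empty_or_nonempty with h0 | h0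
        · simp [h0, hd]
        · simp [h0]
    calc _ ≤ ∑' i, ((⨆ _ : (t i).Nonempty, ediam (t i) ^ d) + e i) := ENNReal.tsum_le_tsum key
      _ = (∑' i, ⨆ _ : (t i).Nonempty, ediam (t i) ^ d) + ∑' i, (e i : ℝ≥0∞) := ENNReal.tsum_add
      _ ≤ ε / 2 + ε / 2 := add_le_add hs.le he.le
      _ = ε := ENNReal.add_halves ε

theorem prod_null {X : Type*} [EMetricSpace X] [MeasurableSpace X] [BorelSpace X]
    [MeasurableSpace (X × ℝ)] [BorelSpace (X × ℝ)]
    {d : ℝ} (hd : 0 < d) {F : Set X} (hF : μH[d] F = 0) :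
    μH[d + 1] (F ×ˢ Set.Icc (0:ℝ) 1) = 0 := by
  have h := fun k : ℕ => cover_aux hd hF (1/((k:ℝ≥0)+1)) (by positivity) ((1/((k:ℝ≥0)+1) : ℝ≥0) : ℝ≥0∞)
    (by
      have : 0 < 1/((k:ℝ≥0)+1) := by positivity
      exact_mod_cast this.ne')
  choose t ρ ht1 ht2 hρ0 hρ1 hs using h
  have hlim0 : Tendsto (fun k : ℕ => 1/((k:ℝ≥0)+1)) atTop (𝓝 0) := by
    exact tendsto_one_div_add_atTop_nhds_zero_nat
  have hlim : Tendsto (fun k : ℕ => ((1/((k:ℝ≥0)+1) : ℝ≥0) : ℝ≥0∞)) atTop (𝓝 0) := by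
    rw [← ENNReal.coe_zero]
    exact ENNReal.tendsto_coe.2 hlim0
  let ι : ℕ → Type := fun k => Σ i : ℕ, Fin (⌈(1 / (ρ k i : ℝ))⌉₊ )
  let T : ∀ k, ι k → Set (X × ℝ) := fun k p =>
    t k p.1 ×ˢ Set.Icc ((p.2 : ℕ) * (ρ k p.1 : ℝ)) (((p.2 : ℕ) + 1) * (ρ k p.1 : ℝ))
  have hdiam : ∀ k p, ediam (T k p) ≤ ρ k p.1 := by
    intro k p
    refine Metric.ediam_le ?_
    rintro ⟨x, a⟩ ⟨hx, ha⟩ ⟨y, b⟩ ⟨hy, hb⟩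
    rw [Prod.edist_eq]
    refine max_le ((Metric.edist_le_ediam_of_mem hx hy).trans (ht2 _ _)) ?_
    have := Real.dist_le_of_mem_Icc ha hb
    rw [edist_dist]
    refine ENNReal.ofReal_le_of_le_toReal ?_
    rw [ENNReal.coe_toReal]
    refine this.trans (le_of_eq (by ring))
  have hsum : ∀ k, ∑' p, ediam (T k p) ^ (d+1) ≤ 2 * ((1/((k:ℝ≥0)+1) : ℝ≥0) : ℝ≥0∞) := by
    intro k
    calc ∑' p, ediam (T k p) ^ (d+1) ≤ ∑' p : ι k, (ρ k p.1 : ℝ≥0∞) ^ (d+1) := by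
          refine ENNReal.tsum_le_tsum fun p => ?_
          exact ENNReal.rpow_le_rpow (hdiam k p) (by positivity)
      _ = ∑' i, ∑' j : Fin (⌈(1 / (ρ k i : ℝ))⌉₊ ), (ρ k i : ℝ≥0∞) ^ (d+1) :=
          ENNReal.tsum_sigma' (fun p : ι k => (ρ k p.1 : ℝ≥0∞) ^ (d+1))
      _ ≤ ∑' i, 2 * (ρ k i : ℝ≥0∞) ^ d := by
          refine ENNReal.tsum_le_tsum fun i => ?_
          rw [tsum_fintype]
          simp only [Finset.sum_const, Finset.card_univ, Fintype.card_fin, nsmul_eq_mul]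
          have hp := hρ0 k i
          have hle : ρ k i ≤ 1 := (hρ1 k i).trans (by
            rw [div_le_one (by positivity)]; simp)
          rw [ENNReal.rpow_add _ _ (by exact_mod_cast hp.ne') (by simp), ENNReal.rpow_one,
            mul_comm (_ ^ d), ← mul_assoc]
          gcongr
          have : ((⌈(1 / (ρ k i : ℝ))⌉₊ : ℝ≥0) * ρ k i : ℝ≥0) ≤ 2 := by
            rw [← NNReal.coe_le_coe]
            push_cast
            have hp' : (0:ℝ) < ρ k i := hp
            have hle' : (ρ k i : ℝ) ≤ 1 := hle
            have h3 := (Nat.ceil_lt_add_one (a := 1 / (ρ k i : ℝ)) (by positivity)).le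
            calc (⌈(1 / (ρ k i : ℝ))⌉₊ : ℝ) * ρ k i ≤ (1 / (ρ k i : ℝ) + 1) * ρ k i := by gcongr
              _ = 1 + ρ k i := by field_simp
              _ ≤ 2 := by linarith
          exact_mod_cast this
      _ = 2 * ∑' i, (ρ k i : ℝ≥0∞) ^ d := ENNReal.tsum_mul_left
      _ ≤ _ := by gcongr; exact hs k
  have := hausdorffMeasure_le_liminf_tsum (d+1) (F ×ˢ Set.Icc (0:ℝ) 1) _ hlim T
    (Eventually.of_forall fun k p => (hdiam k p).trans (by exact_mod_cast hρ1 k p.1))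
    (Eventually.of_forall fun k => by
      rintro ⟨x, a⟩ ⟨hx, ha⟩
      obtain ⟨i, hi⟩ := Set.mem_iUnion.1 (ht1 k hx)
      have hp : (0:ℝ) < ρ k i := hρ0 k i
      simp only [Set.mem_Icc] at ha
      by_cases ha1 : a = 0
      · refine Set.mem_iUnion.2 ⟨⟨i, ⟨0, ?_⟩⟩, hi, ?_⟩
        · exact Nat.ceil_pos.2 (by positivity)
        · simp [ha1]
      have ha0 : 0 < a := lt_of_le_of_ne ha.1 (Ne.symm ha1)
      have hc : 0 < ⌈a / ρ k i⌉₊ := Nat.ceil_pos.2 (by positivity)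
      have hcc : ((⌈a / ρ k i⌉₊ - 1 : ℕ) : ℝ) = (⌈a / ρ k i⌉₊ : ℝ) - 1 := by
        rw [Nat.cast_sub hc]; simp
      refine Set.mem_iUnion.2 ⟨⟨i, ⟨⌈a / ρ k i⌉₊ - 1, ?_⟩⟩, hi, ?_⟩
      · have : ⌈a / ρ k i⌉₊ ≤ ⌈(1 / (ρ k i : ℝ))⌉₊ := Nat.ceil_le_ceil (by gcongr; exact ha.2)
        omega
      · simp only [Set.mem_Icc, hcc]
        have h3 := (Nat.ceil_lt_add_one (a := a / (ρ k i : ℝ)) (by positivity)).le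
        have h4 := Nat.le_ceil (a / (ρ k i : ℝ))
        constructor
        · rw [← le_div_iff₀ hp]; linarith
        · rw [sub_add_cancel, ← div_le_iff₀ hp]; exact h4)
  refine le_antisymm (this.trans ?_) bot_le
  have hl2 : Tendsto (fun k : ℕ => 2 * ((1/((k:ℝ≥0)+1) : ℝ≥0) : ℝ≥0∞)) atTop (𝓝 0) := by
    simpa using ENNReal.Tendsto.const_mul hlim (Or.inr (by simp : (2:ℝ≥0∞) ≠ ∞))
  calc _ ≤ liminf (fun k : ℕ => 2 * ((1/((k:ℝ≥0)+1) : ℝ≥0) : ℝ≥0∞)) atTop :=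
        liminf_le_liminf (Eventually.of_forall hsum)
    _ = 0 := hl2.liminf_eq

theorem bad_dim {n : ℕ} (F : Set (EuclideanSpace ℝ (Fin n)))
    (hdim : dimH F < (n : ℝ≥0∞) - 2) (q : ℝ × ℝ → EuclideanSpace ℝ (Fin n)) {K : ℝ≥0}
    (hq : LipschitzWith K q) :
    dimH {v | ∃ x ∈ Set.Icc (0:ℝ) 1, ∃ y ∈ Set.Icc (0:ℝ) 1, q (x, y) + v ∈ F} < n := by
  obtain ⟨d, hd1, hd2⟩ := ENNReal.lt_iff_exists_nnreal_btwn.1 hdim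
  have hd : 0 < (d : ℝ) := by
    have : 0 < (d : ℝ≥0∞) := lt_of_le_of_lt bot_le hd1
    exact_mod_cast this
  have h0 := hausdorffMeasure_of_dimH_lt hd1
  have h1 := prod_null hd h0
  have h2 := prod_null (by positivity) h1
  have h3 : dimH ((F ×ˢ Set.Icc (0:ℝ) 1) ×ˢ Set.Icc (0:ℝ) 1) ≤ ((d + 1 + 1 : ℝ≥0) : ℝ≥0∞) := by
    refine dimH_le_of_hausdorffMeasure_ne_top ?_
    push_cast
    rw [h2]; simp
  have hL : LipschitzWith (1 + K * 1)
      (fun z : (EuclideanSpace ℝ (Fin n) × ℝ) × ℝ => z.1.1 - q (z.1.2, z.2)) := by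
    refine LipschitzWith.sub ?_ (hq.comp ?_)
    · simpa using! LipschitzWith.prod_fst.comp (LipschitzWith.prod_fst
        (α := EuclideanSpace ℝ (Fin n) × ℝ) (β := ℝ))
    · simpa using! (LipschitzWith.prod_snd.comp (LipschitzWith.prod_fst
        (α := EuclideanSpace ℝ (Fin n) × ℝ) (β := ℝ))).prodMk LipschitzWith.prod_snd
  have h4 := (hL.dimH_image_le ((F ×ˢ Set.Icc (0:ℝ) 1) ×ˢ Set.Icc (0:ℝ) 1)).trans h3
  refine lt_of_le_of_lt (dimH_mono ?_) (lt_of_le_of_lt h4 ?_)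
  · rintro v ⟨x, hx, y, hy, h⟩
    exact ⟨((q (x, y) + v, x), y), ⟨⟨h, hx⟩, hy⟩, by simp⟩
  · have := lt_tsub_iff_right.1 hd2
    push_cast
    rwa [add_assoc, one_add_one_eq_two]

theorem lip_approx_real {X : Type*} [MetricSpace X] [CompactSpace X] (f : C(X, ℝ)) {ε : ℝ}
    (hε : 0 < ε) : ∃ (g : X → ℝ) (K : ℝ≥0), LipschitzWith K g ∧ ∀ x, dist (f x) (g x) < ε := by
  let L : Set C(X, ℝ) := {g | ∃ K : ℝ≥0, LipschitzWith K g}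
  have hL : closure L = ⊤ := by
    refine ContinuousMap.sublattice_closure_eq_top L ⟨0, 0, LipschitzWith.const 0⟩ ?_ ?_ ?_
    · rintro f ⟨K, hf⟩ g ⟨K', hg⟩
      exact ⟨_, hf.min hg⟩
    · rintro f ⟨K, hf⟩ g ⟨K', hg⟩
      exact ⟨_, hf.max hg⟩
    · intro v x y
      have hlip : LipschitzWith (‖(v y - v x) / dist x y‖₊ * 1 + 0)
          (fun z => (v y - v x) / dist x y * dist x z + v x) := by
        refine LipschitzWith.add ?_ (LipschitzWith.const _)
        have := (lipschitzWith_smul ((v y - v x) / dist x y)).comp (LipschitzWith.dist_right x)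
        simpa using! this
      refine ⟨⟨_, hlip.continuous⟩, ⟨_, hlip⟩, by simp, ?_⟩
      rcases eq_or_ne x y with rfl | h
      · simp
      · have := dist_ne_zero.2 h
        simp only [ContinuousMap.coe_mk]
        field_simp
        ring
  have hf : f ∈ closure L := by rw [hL]; trivial
  obtain ⟨g, ⟨K, hK⟩, hg⟩ := Metric.mem_closure_iff.1 hf ε hε
  exact ⟨g, K, hK, fun x => lt_of_le_of_lt (ContinuousMap.dist_apply_le_dist x) hg⟩

theorem lip_approx {X : Type*} [MetricSpace X] [CompactSpace X] {n : ℕ}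
    (f : X → EuclideanSpace ℝ (Fin n)) (hf : Continuous f) {ε : ℝ}
    (hε : 0 < ε) : ∃ (g : X → EuclideanSpace ℝ (Fin n)) (K : ℝ≥0), LipschitzWith K g ∧
      ∀ x, dist (f x) (g x) < ε := by
  obtain ⟨C, hL⟩ : ∃ C : ℝ≥0,
      LipschitzWith C (WithLp.toLp 2 : (Fin n → ℝ) → EuclideanSpace ℝ (Fin n)) :=
    ⟨_, PiLp.lipschitzWith_toLp 2 (fun _ : Fin n => ℝ)⟩
  have hpos : 0 < ε / (C + 1) := by positivity
  have := fun i : Fin n => lip_approx_real (X := X)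
    ⟨fun x => f x i, by fun_prop⟩ hpos
  choose g K hK hg using this
  refine ⟨fun x => WithLp.toLp 2 (fun i => g i x), C * (∑ i, K i), hL.comp ?_, fun x => ?_⟩
  · refine LipschitzWith.of_dist_le_mul fun x y => ?_
    refine (dist_pi_le_iff (by positivity)).2 fun i => ?_
    refine ((hK i).dist_le_mul x y).trans ?_
    gcongr
    exact Finset.single_le_sum (f := K) (fun _ _ => bot_le) (Finset.mem_univ i)
  · have h1 := hL.dist_le_mul (fun i => f x i) (fun i => g i x)
    have h2 : dist (fun i => f x i) (fun i => g i x) ≤ ε / (C + 1) :=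
      (dist_pi_le_iff hpos.le).2 fun i => (hg i x).le
    refine lt_of_le_of_lt h1 ?_
    calc C * dist (fun i => f x i) (fun i => g i x) ≤ C * (ε / (C + 1)) := by gcongr
      _ < (C + 1) * (ε / (C + 1)) := by gcongr; simp
      _ = ε := by field_simp

open scoped unitInterval

theorem cone_lip {n : ℕ} (h : ℝ → EuclideanSpace ℝ (Fin n)) {K M : ℝ≥0} (hK : LipschitzWith K h)
    (hM : ∀ x, ‖h x‖ ≤ M) (a : EuclideanSpace ℝ (Fin n)) :
    LipschitzWith (M + K) (fun z : ℝ × ℝ =>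
      a + ((Set.projIcc (0:ℝ) 1 zero_le_one z.2 : I) : ℝ) • h z.1) := by
  refine LipschitzWith.of_dist_le_mul ?_
  rintro ⟨x, s⟩ ⟨y, t⟩
  simp only [dist_add_left]
  set s' := Set.projIcc (0:ℝ) 1 zero_le_one s
  set t' := Set.projIcc (0:ℝ) 1 zero_le_one t
  have h1 : dist (s' : ℝ) (t' : ℝ) ≤ dist s t := by
    have := (LipschitzWith.projIcc (zero_le_one (α := ℝ))).dist_le_mul s t
    rw [NNReal.coe_one, one_mul] at this
    exact this
  have h2 : dist s t ≤ dist (x, s) (y, t) := by rw [Prod.dist_eq]; exact le_max_right _ _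
  have h3 : dist x y ≤ dist (x, s) (y, t) := by rw [Prod.dist_eq]; exact le_max_left _ _
  have h4 := hK.dist_le_mul x y
  have e : (s' : ℝ) • h x - (t' : ℝ) • h y = ((s' : ℝ) - t') • h x + (t' : ℝ) • (h x - h y) := by
    module
  rw [dist_eq_norm, e]
  refine (norm_add_le _ _).trans ?_
  rw [norm_smul, norm_smul, ← dist_eq_norm, ← dist_eq_norm, Real.norm_of_nonneg t'.2.1]
  push_cast
  rw [add_mul]
  refine add_le_add ?_ ?_
  · rw [mul_comm]
    exact mul_le_mul (hM x) (h1.trans h2) dist_nonneg M.2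
  · calc (t' : ℝ) * dist (h x) (h y) ≤ 1 * dist (h x) (h y) := by gcongr; exact t'.2.2
      _ ≤ K * dist x y := by rw [one_mul]; exact h4
      _ ≤ _ := by gcongr

theorem choose_v {n : ℕ} (F : Set (EuclideanSpace ℝ (Fin n)))
    (hdim : dimH F < (n : ℝ≥0∞) - 2) (q₁ q₂ : ℝ × ℝ → EuclideanSpace ℝ (Fin n)) {K₁ K₂ : ℝ≥0}
    (hq₁ : LipschitzWith K₁ q₁) (hq₂ : LipschitzWith K₂ q₂) {ε : ℝ} (hε : 0 < ε) :
    ∃ v, ‖v‖ < ε ∧ (∀ x ∈ Set.Icc (0:ℝ) 1, ∀ y ∈ Set.Icc (0:ℝ) 1, q₁ (x, y) + v ∉ F) ∧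
      (∀ x ∈ Set.Icc (0:ℝ) 1, ∀ y ∈ Set.Icc (0:ℝ) 1, q₂ (x, y) + v ∉ F) := by
  have h1 := bad_dim F hdim q₁ hq₁
  have h2 := bad_dim F hdim q₂ hq₂
  have h3 := max_lt h1 h2
  rw [← dimH_union] at h3
  have hd := dense_compl_of_dimH_lt_finrank (E := EuclideanSpace ℝ (Fin n)) (lt_of_lt_of_eq h3 (by simp))
  obtain ⟨v, hv, hv2⟩ := Metric.dense_iff.1 hd 0 ε hε
  refine ⟨v, by simpa using hv, ?_, ?_⟩
  · intro x hx y hy h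
    exact hv2 (Or.inl ⟨x, hx, y, hy, h⟩)
  · intro x hx y hy h
    exact hv2 (Or.inr ⟨x, hx, y, hy, h⟩)

theorem hom_of {E X : Type*} [TopologicalSpace E] [TopologicalSpace X] {W : Set E}
    (f₀ f₁ : C(X, W)) (k : I × X → E) (hk : Continuous k) (hW : ∀ z, k z ∈ W)
    (h0 : ∀ x, k (0, x) = f₀ x) (h1 : ∀ x, k (1, x) = f₁ x) : ContinuousMap.Homotopic f₀ f₁ :=
  ⟨{ toFun := fun z => ⟨k z, hW z⟩
     continuous_toFun := by fun_prop
     map_zero_left := fun x => Subtype.ext (h0 x)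
     map_one_left := fun x => Subtype.ext (h1 x) }⟩

theorem line_near {E : Type*} [NormedAddCommGroup E] [NormedSpace ℝ E] (a b : E) (t : I) {ε : ℝ}
    (h : dist b a < ε) : dist (a + (t : ℝ) • (b - a)) a < ε := by
  rw [dist_eq_norm, add_sub_cancel_left, norm_smul, Real.norm_of_nonneg t.2.1, ← dist_eq_norm]
  calc (t : ℝ) * dist b a ≤ 1 * dist b a := by gcongr; exact t.2.2
    _ < ε := by rwa [one_mul]

theorem near_range {E X : Type*} [MetricSpace E] [TopologicalSpace X] [CompactSpace X]
    {f : X → E} (hf : Continuous f) {W : Set E} (hW : IsOpen W) (h : ∀ x, f x ∈ W) :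
    ∃ ε > 0, ∀ x y, dist y (f x) < ε → y ∈ W := by
  obtain ⟨ε, h0, hε⟩ := (isCompact_range hf).exists_thickening_subset_open hW
    (Set.range_subset_iff.2 h)
  exact ⟨ε, h0, fun x y hy => hε (Metric.mem_thickening_iff.2 ⟨f x, ⟨x, rfl⟩, hy⟩)⟩

theorem circle_param : ∃ (p : ℝ → sphere (0 : EuclideanSpace ℝ (Fin 2)) 1) (K : ℝ≥0),
    LipschitzWith K p ∧ ∀ x, ∃ t ∈ Set.Icc (0:ℝ) 1, p t = x := by
  have hmem : ∀ θ : ℝ, (!₂[Real.cos θ, Real.sin θ] : EuclideanSpace ℝ (Fin 2)) ∈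
      sphere (0 : EuclideanSpace ℝ (Fin 2)) 1 := by
    intro θ
    simp [EuclideanSpace.norm_eq]
  obtain ⟨C, hL⟩ : ∃ C : ℝ≥0,
      LipschitzWith C (WithLp.toLp 2 : (Fin 2 → ℝ) → EuclideanSpace ℝ (Fin 2)) :=
    ⟨_, PiLp.lipschitzWith_toLp 2 (fun _ : Fin 2 => ℝ)⟩
  have hl : LipschitzWith 1 (fun θ : ℝ => (![Real.cos θ, Real.sin θ] : Fin 2 → ℝ)) := by
    refine LipschitzWith.of_dist_le_mul fun x y => ?_
    refine (dist_pi_le_iff (by positivity)).2 fun i => ?_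
    fin_cases i
    · exact Real.lipschitzWith_cos.dist_le_mul x y
    · exact Real.lipschitzWith_sin.dist_le_mul x y
  have hm : LipschitzWith (Real.toNNReal (2 * Real.pi))
      (fun t : ℝ => 2 * Real.pi * t - Real.pi) := by
    refine LipschitzWith.of_dist_le_mul fun x y => ?_
    rw [Real.dist_eq, Real.dist_eq]
    rw [Real.coe_toNNReal _ (by positivity), sub_sub_sub_cancel_right, ← mul_sub, abs_mul, abs_of_pos (a := 2 * Real.pi) (by positivity)]
  refine ⟨fun t => ⟨_, hmem (2 * Real.pi * t - Real.pi)⟩, _,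
    ((hL.comp hl).comp hm).subtype_mk _, fun x => ?_⟩
  have hx : ‖(⟨x.1 0, x.1 1⟩ : ℂ)‖ = 1 := by
    have := x.2
    rw [mem_sphere_zero_iff_norm, EuclideanSpace.norm_eq] at this
    rw [Complex.norm_eq_sqrt_sq_add_sq]
    simpa using this
  have hx0 : (⟨x.1 0, x.1 1⟩ : ℂ) ≠ 0 := by
    intro h; rw [h] at hx; simp at hx
  set z : ℂ := ⟨x.1 0, x.1 1⟩ with hz
  have hpi := Real.pi_pos
  refine ⟨(z.arg + Real.pi) / (2 * Real.pi), ⟨?_, ?_⟩, ?_⟩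
  · have := Complex.neg_pi_lt_arg z
    exact div_nonneg (by linarith) (by positivity)
  · have := Complex.arg_le_pi z
    rw [div_le_one (by positivity)]; linarith
  · have e : 2 * Real.pi * ((z.arg + Real.pi) / (2 * Real.pi)) - Real.pi = z.arg := by
      field_simp; ring
    apply Subtype.ext
    simp only [e]
    rw [Complex.cos_arg hx0, Complex.sin_arg, hx]
    ext i
    fin_cases i <;> simp [hz]

theorem part_one (n : ℕ)
    (U : Set (EuclideanSpace ℝ (Fin n))) (hU : IsOpen U)
    (F : Set (EuclideanSpace ℝ (Fin n))) (hF : IsClosed F)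
    (hdim : dimH F < (n : ℝ≥0∞) - 2)
    (γ : C(↥(sphere (0 : EuclideanSpace ℝ (Fin 2)) 1), ↥(U \ F)))
    (c : ↥U) (hc : ContinuousMap.Homotopic
        ((⟨Set.inclusion Set.diff_subset, continuous_inclusion Set.diff_subset⟩ :
          C(↥(U \ F), ↥U)).comp γ)
        (ContinuousMap.const _ c)) :
      ∃ c' : ↥(U \ F), ContinuousMap.Homotopic γ (ContinuousMap.const _ c') := by
  obtain ⟨H⟩ := hc
  obtain ⟨p, Kp, hp, hps⟩ := circle_param
  set f : I × sphere (0 : EuclideanSpace ℝ (Fin 2)) 1 → EuclideanSpace ℝ (Fin n) :=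
    fun z => (H z : EuclideanSpace ℝ (Fin n)) with hf
  have hfc : Continuous f := by fun_prop
  have hf0 : ∀ x, f (0, x) = γ x := fun x => by simp [hf]
  have hf1 : ∀ x, f (1, x) = c := fun x => by simp [hf]
  obtain ⟨ε₁, hε₁, hn₁⟩ := near_range hfc hU (fun z => (H z).2)
  obtain ⟨ε₂, hε₂, hn₂⟩ := near_range (f := fun x => (γ x : EuclideanSpace ℝ (Fin n)))
    (by fun_prop) (hU.sdiff hF) (fun z => (γ z).2)
  set ε := min ε₁ ε₂ with hεd
  have hε : 0 < ε := lt_min hε₁ hε₂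
  obtain ⟨g, Kg, hg, hgf⟩ := lip_approx f hfc (half_pos hε)
  have hgc : Continuous g := hg.continuous
  have hG : LipschitzWith (Kg * (max (1 * 1) (Kp * 1)))
      (fun z : ℝ × ℝ => g (Set.projIcc (0:ℝ) 1 zero_le_one z.2, p z.1)) :=
    hg.comp (((LipschitzWith.projIcc zero_le_one).comp LipschitzWith.prod_snd).prodMk
      (hp.comp LipschitzWith.prod_fst))
  have hh : LipschitzWith (Kg * (max 0 Kp) + 0)
      (fun x => g (1, p x) - (c : EuclideanSpace ℝ (Fin n))) :=
    (hg.comp ((LipschitzWith.const _).prodMk hp)).sub (LipschitzWith.const _)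
  have hb : ∀ x, ‖g (1, p x) - (c : EuclideanSpace ℝ (Fin n))‖ ≤ (⟨ε / 2, by positivity⟩ : ℝ≥0) := by
    intro x
    have := hgf (1, p x)
    rw [hf1, dist_comm, dist_eq_norm] at this
    exact this.le
  obtain ⟨v, hv, hv1, hv2⟩ := choose_v F hdim _ _ hG (cone_lip _ hh hb c) (half_pos hε)
  have hv1' : ∀ z, g z + v ∉ F := by
    rintro ⟨s, x⟩
    obtain ⟨t, ht, rfl⟩ := hps x
    simpa using hv1 t ht s s.2
  have hv2' : ∀ (s : I) x, c + (s : ℝ) • (g (1, x) - (c : EuclideanSpace ℝ (Fin n))) + v ∉ F := by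
    intro s x
    obtain ⟨t, ht, rfl⟩ := hps x
    simpa using hv2 t ht s s.2
  have hnear : ∀ z, dist (g z + v) (f z) < ε := by
    intro z
    calc dist (g z + v) (f z) ≤ dist (g z + v) (g z) + dist (g z) (f z) := dist_triangle _ _ _
      _ < ε / 2 + ε / 2 := by
        refine add_lt_add ?_ ?_
        · simpa using hv
        · rw [dist_comm]; exact hgf z
      _ = ε := by ring
  have hGU : ∀ z, g z + v ∈ U \ F := fun z =>
    ⟨hn₁ z _ ((hnear z).trans_le (min_le_left _ _)), hv1' z⟩
  have hG2U : ∀ (s : I) x, c + (s : ℝ) • (g (1, x) - (c : EuclideanSpace ℝ (Fin n))) + v ∈ U \ F := by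
    intro s x
    refine ⟨hn₁ (1, x) _ ?_, hv2' s x⟩
    rw [hf1]
    have h1 := hgf (1, x)
    rw [hf1, dist_comm] at h1
    have h2 := line_near _ _ s h1
    calc _ ≤ _ + _ := dist_triangle _ (c + (s : ℝ) • (g (1, x) - (c : EuclideanSpace ℝ (Fin n)))) _
      _ < ε / 2 + ε / 2 := add_lt_add (by simpa using hv) h2
      _ = ε := by ring
      _ ≤ ε₁ := min_le_left _ _
  have hcv : (c : EuclideanSpace ℝ (Fin n)) + v ∈ U \ F := by
    simpa using hG2U 0 (p 0)
  refine ⟨⟨c + v, hcv⟩, ?_⟩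
  let g0 : C(sphere (0 : EuclideanSpace ℝ (Fin 2)) 1, ↥(U \ F)) :=
    ⟨fun x => ⟨g (0, x) + v, hGU _⟩, by fun_prop⟩
  let g1 : C(sphere (0 : EuclideanSpace ℝ (Fin 2)) 1, ↥(U \ F)) :=
    ⟨fun x => ⟨g (1, x) + v, hGU _⟩, by fun_prop⟩
  have s1 : ContinuousMap.Homotopic γ g0 := by
    refine hom_of _ _ (fun z => (γ z.2 : EuclideanSpace ℝ (Fin n)) +
      (z.1 : ℝ) • (g (0, z.2) + v - γ z.2)) (by fun_prop) ?_ (by simp) (by simp [g0])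
    intro z
    refine hn₂ z.2 _ ((line_near _ _ _ ?_).trans_le (min_le_right _ _ : ε ≤ ε₂))
    have := hnear (0, z.2)
    rwa [hf0] at this
  have s2 : ContinuousMap.Homotopic g0 g1 :=
    hom_of _ _ (fun z => g z + v) (by fun_prop) hGU (fun _ => rfl) (fun _ => rfl)
  have s3 : ContinuousMap.Homotopic (ContinuousMap.const _ ⟨c + v, hcv⟩) g1 :=
    hom_of _ _ (fun z => c + (z.1 : ℝ) • (g (1, z.2) - (c : EuclideanSpace ℝ (Fin n))) + v)
      (by fun_prop) (fun z => hG2U _ _) (by simp) (by simp [g1])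
  exact s1.trans (s2.trans s3.symm)

theorem square {Y : Type*} [TopologicalSpace Y] (K : C(I × I, Y)) {a b c d : Y}
    (p : Path a b) (q : Path b d) (q' : Path a c) (p' : Path c d)
    (hp : ∀ t, K (t, 0) = p t) (hq : ∀ t, K (1, t) = q t) (hq' : ∀ t, K (0, t) = q' t)
    (hp' : ∀ t, K (t, 1) = p' t) : Path.Homotopic (p.trans q) (q'.trans p') := by
  have ha : K (0, 0) = a := by rw [hp]; simp
  have hb : K (1, 0) = b := by rw [hp]; simp
  have hc : K (0, 1) = c := by rw [hp']; simp
  have hd : K (1, 1) = d := by rw [hp']; simp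
  subst ha hb hc hd
  let e1 : Path ((0, 0) : I × I) (1, 0) := ⟨⟨fun t => (t, 0), by fun_prop⟩, rfl, rfl⟩
  let e2 : Path ((1, 0) : I × I) (1, 1) := ⟨⟨fun t => (1, t), by fun_prop⟩, rfl, rfl⟩
  let e3 : Path ((0, 0) : I × I) (0, 1) := ⟨⟨fun t => (0, t), by fun_prop⟩, rfl, rfl⟩
  let e4 : Path ((0, 1) : I × I) (1, 1) := ⟨⟨fun t => (t, 1), by fun_prop⟩, rfl, rfl⟩
  have : ContractibleSpace I :=
    (convex_Icc (0:ℝ) 1).contractibleSpace ⟨0, by simp⟩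
  have h : Path.Homotopic (e1.trans e2) (e3.trans e4) := SimplyConnectedSpace.paths_homotopic _ _
  have h' := h.map K
  have e1' : p = e1.map K.continuous := by ext t; exact (hp t).symm
  have e2' : q = e2.map K.continuous := by ext t; exact (hq t).symm
  have e3' : q' = e3.map K.continuous := by ext t; exact (hq' t).symm
  have e4' : p' = e4.map K.continuous := by ext t; exact (hp' t).symm
  rw [e1', e2', e3', e4', ← Path.map_trans, ← Path.map_trans]
  exact h'

theorem part_two (n : ℕ)
    (F : Set (EuclideanSpace ℝ (Fin n))) (hF : IsClosed F)
    (hdim : dimH F < (n : ℝ≥0∞) - 2) : SimplyConnectedSpace ↥(Fᶜ) := by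
  rw [simply_connected_iff_loops_nullhomotopic]
  constructor
  · rw [← isPathConnected_iff_pathConnectedSpace, isPathConnected_iff]
    constructor
    · obtain ⟨v, -, hv, -⟩ := choose_v F hdim (fun _ => 0) (fun _ => 0)
        (LipschitzWith.const 0) (LipschitzWith.const 0) one_pos
      exact ⟨v, by simpa using hv 0 (by simp) 0 (by simp)⟩
    · intro a ha b hb
      obtain ⟨ε₁, h₁, hn₁⟩ := Metric.isOpen_iff.1 hF.isOpen_compl a ha
      obtain ⟨ε₂, h₂, hn₂⟩ := Metric.isOpen_iff.1 hF.isOpen_compl b hb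
      obtain ⟨v, hv, hv1, -⟩ := choose_v F hdim _ (fun _ => 0)
        (cone_lip (fun _ => b - a) (LipschitzWith.const _) (M := ‖b - a‖₊) (by simp) a)
        (LipschitzWith.const 0) (lt_min h₁ h₂)
      have j1 : JoinedIn Fᶜ a (a + v) := by
        refine JoinedIn.of_segment_subset (((convex_ball a ε₁).segment_subset ?_ ?_).trans hn₁)
        · simpa using h₁
        · simpa using hv.trans_le (min_le_left _ _)
      have j2 : JoinedIn Fᶜ b (b + v) := by
        refine JoinedIn.of_segment_subset (((convex_ball b ε₂).segment_subset ?_ ?_).trans hn₂)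
        · simpa using h₂
        · simpa using hv.trans_le (min_le_right _ _)
      have j3 : JoinedIn Fᶜ (a + v) (b + v) := by
        refine JoinedIn.of_segment_subset ?_
        rw [segment_eq_image']
        rintro _ ⟨t, ht, rfl⟩
        have := hv1 0 (by simp) t ht
        simp only [Set.projIcc_of_mem zero_le_one ht] at this
        have e : a + v + t • (b + v - (a + v)) = a + t • (b - a) + v := by module
        simp only [e]
        exact this
      exact j1.trans (j3.trans j2.symm)
  · intro x γ
    set f : I → EuclideanSpace ℝ (Fin n) := fun t => (γ t : EuclideanSpace ℝ (Fin n)) with hf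
    have hfc : Continuous f := by fun_prop
    have hf0 : f 0 = x := by simp [hf]
    have hf1 : f 1 = x := by simp [hf]
    obtain ⟨ε, hε, hn⟩ := near_range hfc hF.isOpen_compl (fun z => (γ z).2)
    have hε4 : 0 < ε / 4 := by positivity
    obtain ⟨g₀, Kg, hg₀, hgf⟩ := lip_approx f hfc hε4
    have hx0 := hgf 0
    have hx1 := hgf 1
    rw [hf0] at hx0
    rw [hf1] at hx1
    let w : EuclideanSpace ℝ (Fin n) := g₀ 0 - g₀ 1
    let g : I → EuclideanSpace ℝ (Fin n) := fun t => g₀ t + (x - g₀ 0) + (t : ℝ) • w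
    have hg0 : g 0 = x := by simp [g]
    have hg1 : g 1 = x := by simp [g, w]; abel
    have hgL : LipschitzWith (Kg + 0 + ‖w‖₊) g := by
      refine (hg₀.add (LipschitzWith.const _)).add ?_
      refine LipschitzWith.of_dist_le_mul fun s t => ?_
      rw [dist_eq_norm, ← sub_smul, norm_smul, mul_comm]
      exact le_rfl
    have hgc : Continuous g := hgL.continuous
    have hnear : ∀ t, dist (g t) (f t) < ε / 2 := by
      intro t
      have e : g t - f t = (g₀ t - f t) + ((1 - (t : ℝ)) • (x - g₀ 0) + (t : ℝ) • (x - g₀ 1)) := by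
        simp only [g, w]; module
      rw [dist_eq_norm, e]
      have hc : ‖(1 - (t : ℝ)) • ((x : EuclideanSpace ℝ (Fin n)) - g₀ 0) + (t : ℝ) • (x - g₀ 1)‖ ≤ ε / 4 := by
        refine (norm_add_le _ _).trans ?_
        rw [norm_smul, norm_smul, Real.norm_of_nonneg t.2.1,
          Real.norm_of_nonneg (sub_nonneg.2 t.2.2), ← dist_eq_norm, ← dist_eq_norm]
        have a1 := mul_le_mul_of_nonneg_left hx0.le (sub_nonneg.2 t.2.2)
        have a2 := mul_le_mul_of_nonneg_left hx1.le t.2.1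
        linarith
      have hd := hgf t
      rw [dist_comm, dist_eq_norm] at hd
      have := norm_add_le (g₀ t - f t) ((1 - (t : ℝ)) • ((x : EuclideanSpace ℝ (Fin n)) - g₀ 0) + (t : ℝ) • (x - g₀ 1))
      linarith
    have hh : LipschitzWith ((Kg + 0 + ‖w‖₊) * 1 + 0)
        (fun s => g (Set.projIcc (0:ℝ) 1 zero_le_one s) - (x : EuclideanSpace ℝ (Fin n))) :=
      (hgL.comp (LipschitzWith.projIcc zero_le_one)).sub (LipschitzWith.const _)
    obtain ⟨M, hM⟩ : ∃ M : ℝ≥0, ∀ t, ‖g t - (x : EuclideanSpace ℝ (Fin n))‖ ≤ M := by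
      refine ⟨Kg + 0 + ‖w‖₊, fun t => ?_⟩
      have := hgL.dist_le_mul t 0
      rw [hg0, dist_eq_norm] at this
      refine this.trans (mul_le_of_le_one_right (NNReal.coe_nonneg _) ?_)
      rw [Subtype.dist_eq, Real.dist_eq]
      simpa [abs_of_nonneg t.2.1] using t.2.2
    obtain ⟨v, hv, hv1, -⟩ := choose_v F hdim _ (fun _ => 0)
      (cone_lip _ hh (fun s => hM _) x) (LipschitzWith.const 0) (half_pos hε)
    have hv1' : ∀ s t : I, x + (s : ℝ) • (g t - (x : EuclideanSpace ℝ (Fin n))) + v ∈ Fᶜ := by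
      intro s t
      simpa using hv1 t t.2 s s.2
    have hgv : ∀ t, g t + v ∈ Fᶜ := fun t => by simpa using hv1' 1 t
    have hxv : (x : EuclideanSpace ℝ (Fin n)) + v ∈ Fᶜ := by simpa [hg0] using hgv 0
    have hlin : ∀ t s : I, f t + (s : ℝ) • (g t + v - f t) ∈ Fᶜ := by
      intro t s
      refine hn t _ (line_near _ _ _ ?_)
      calc dist (g t + v) (f t) ≤ dist (g t + v) (g t) + dist (g t) (f t) := dist_triangle _ _ _
        _ < ε / 2 + ε / 2 := add_lt_add (by simpa using hv) (hnear t)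
        _ = ε := by ring
    let y : ↥(Fᶜ) := ⟨x + v, hxv⟩
    let γ' : Path y y := ⟨⟨fun t => ⟨g t + v, hgv t⟩, by fun_prop⟩,
      Subtype.ext (by simp [hg0, y]), Subtype.ext (by simp [hg1, y])⟩
    let q : Path x y := ⟨⟨fun s => ⟨f 0 + (s : ℝ) • (g 0 + v - f 0), hlin 0 s⟩, by fun_prop⟩,
      Subtype.ext (by simp [hf0]), Subtype.ext (by simp [hg0, y])⟩
    have s1 : Path.Homotopic (γ.trans q) (q.trans γ') := by
      refine square ⟨fun z => ⟨f z.1 + (z.2 : ℝ) • (g z.1 + v - f z.1), hlin _ _⟩, by fun_prop⟩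
        _ _ _ _ ?_ ?_ ?_ ?_
      · intro t; apply Subtype.ext; simp [hf]
      · intro t; apply Subtype.ext; simp [q, hf0, hf1, hg0, hg1]
      · intro t; rfl
      · intro t; apply Subtype.ext; simp [γ']
    have s2 : Path.Homotopic ((Path.refl y).trans (Path.refl y)) ((Path.refl y).trans γ') := by
      refine square ⟨fun z => ⟨x + (z.2 : ℝ) • (g z.1 - (x : EuclideanSpace ℝ (Fin n))) + v,
        hv1' _ _⟩, by fun_prop⟩ _ _ _ _ ?_ ?_ ?_ ?_
      · intro t; apply Subtype.ext; simp [y]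
      · intro t; apply Subtype.ext; simp [y, hg1]
      · intro t; apply Subtype.ext; simp [y, hg0]
      · intro t; apply Subtype.ext; simp [γ']
    rw [← Path.Homotopic.Quotient.eq] at s1 s2 ⊢
    simp only [Path.Homotopic.Quotient.mk_trans, Path.Homotopic.Quotient.mk_refl] at s1 s2 ⊢
    have s3 : Path.Homotopic.Quotient.mk γ' = Path.Homotopic.Quotient.refl y := by
      simpa using s2.symm
    rw [s3] at s1
    have s4 := congrArg (fun a => Path.Homotopic.Quotient.trans a
      (Path.Homotopic.Quotient.symm (Path.Homotopic.Quotient.mk q))) s1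
    simpa using s4

end Helpers

/-- A closed set of Hausdorff dimension `< n − 2` is invisible to (local) fundamental
groups: loops in `U \ F` null-homotopic in `U` are null-homotopic in `U \ F`, and
`ℝⁿ \ F` is simply connected. -/
theorem stmt_11 (n : ℕ) (hn : 3 ≤ n)
    (U : Set (EuclideanSpace ℝ (Fin n))) (hU : IsOpen U)
    (F : Set (EuclideanSpace ℝ (Fin n))) (hF : IsClosed F)
    (hdim : dimH F < (n : ℝ≥0∞) - 2) :
    (∀ γ : C(↥(sphere (0 : EuclideanSpace ℝ (Fin 2)) 1), ↥(U \ F)),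
      (∃ c : ↥U, ContinuousMap.Homotopic
        ((⟨Set.inclusion Set.diff_subset, continuous_inclusion Set.diff_subset⟩ :
          C(↥(U \ F), ↥U)).comp γ)
        (ContinuousMap.const _ c)) →
      ∃ c' : ↥(U \ F), ContinuousMap.Homotopic γ (ContinuousMap.const _ c')) ∧
    SimplyConnectedSpace ↥(Fᶜ) := by
  exact ⟨fun γ ⟨c, hc⟩ => part_one n U hU F hF hdim γ c hc, part_two n F hF hdim⟩
end
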